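/- arXiv:2310.06759 — 2 statements merged into one kernel-verified Lean document; each statement's English description precedes it below -/
import Mathlib

section
/- The Domino Problem is undecidable: there is no computable function D from Wang tile sets, encoded as finite lists of quadruples of natural numbers, to Bool such that D(S) = true if and only if S admits a tiling of the plane (Berger). -/
/-- A Wang tile: the colours of its (west, south, east, north) edges. -/
abbrev WangTile : Type := ℕ × ℕ × ℕ × ℕ

def WangTile.west (t : WangTile) : ℕ := t.1
def WangTile.south (t : WangTile) : ℕ := t.2.1
def WangTile.east (t : WangTile) : ℕ := t.2.2.1
def WangTile.north (t : WangTile) : ℕ := t.2.2.2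

/-- The Wang matching conditions for a configuration of tiles on `ℤ × ℤ`. -/
def WangMatch (f : ℤ × ℤ → WangTile) : Prop :=
  ∀ x y : ℤ,
    (f (x, y)).east = (f (x + 1, y)).west ∧ (f (x, y)).north = (f (x, y + 1)).south

/-- A tiling of the plane by the Wang tile set `S`. -/
def IsWangTiling (S : Finset WangTile) (f : ℤ × ℤ → WangTile) : Prop :=
  (∀ p, f p ∈ S) ∧ WangMatch f

/-- A configuration is periodic if it is invariant under some nonzero translation. -/
def WangPeriodic (f : ℤ × ℤ → WangTile) : Prop :=
  ∃ v : ℤ × ℤ, v ≠ 0 ∧ ∀ p, f (p + v) = f p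

/-- A Wang tile set is aperiodic if it admits a tiling of the plane and every tiling
of the plane by it is nonperiodic. -/
def WangAperiodic (S : Finset WangTile) : Prop :=
  (∃ f, IsWangTiling S f) ∧ ∀ f, IsWangTiling S f → ¬ WangPeriodic f

/-- A tiling of the plane by the Wang tile set encoded by the list `l`. -/
def IsWangTilingL (l : List WangTile) (f : ℤ × ℤ → WangTile) : Prop :=
  (∀ p, f p ∈ l) ∧ WangMatch f

namespace Domino
open Turing

theorem trNat_two_pow (n : ℕ) : PartrecToTM2.trNat (2 ^ n) =
    List.replicate n PartrecToTM2.Γ'.bit0 ++ [PartrecToTM2.Γ'.bit1] := by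
  have key : ∀ n : ℕ, ∃ q : PosNum, ((2 ^ n : ℕ) : Num) = Num.pos q ∧
      PartrecToTM2.trPosNum q =
        List.replicate n PartrecToTM2.Γ'.bit0 ++ [PartrecToTM2.Γ'.bit1] := by
    intro n
    induction n with
    | zero => exact ⟨PosNum.one, by simp; rfl, rfl⟩
    | succ n ih =>
      obtain ⟨q, h1, h2⟩ := ih
      refine ⟨PosNum.bit0 q, ?_, ?_⟩
      · have : (2 ^ (n + 1) : ℕ) = 2 ^ n + 2 ^ n := by ring
        rw [this, Nat.cast_add, h1]
        exact congrArg Num.pos (PosNum.bit0_of_bit0 q)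
      · simp [PartrecToTM2.trPosNum, h2, List.replicate_succ]
  obtain ⟨q, h1, h2⟩ := key n
  simp only [PartrecToTM2.trNat, h1]
  exact h2

theorem exists_partrec : ∃ f : ℕ →. ℕ, Partrec f ∧
    ∀ c : Nat.Partrec.Code, (f (2 ^ Encodable.encode c)).Dom ↔ (c.eval 0).Dom := by
  refine ⟨fun m => (Nat.rfind fun n => Part.some (decide (2 ^ n = m))).bind fun n =>
    (Denumerable.ofNat Nat.Partrec.Code n).eval 0, ?_, ?_⟩
  · apply Partrec.bind
    · apply Partrec.rfind
      have h : PrimrecPred fun a : ℕ × ℕ => 2 ^ a.2 = a.1 :=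
        Primrec.eq.comp (((Primrec.nat_rec' (f := fun a : ℕ × ℕ => a.2) (g := fun _ => 1)
          (h := fun _ b => b.2 * 2) Primrec.snd (Primrec.const 1)
          (Primrec.nat_mul.comp (Primrec.snd.comp Primrec.snd) (Primrec.const 2)).to₂)).of_eq
            (by
              rintro ⟨a, b⟩
              simp only
              induction b with
              | zero => rfl
              | succ k ih => simp only at ih ⊢; rw [pow_succ, ← ih])) Primrec.fst
      exact (h.decide.to_comp).partrec
    · exact Nat.Partrec.Code.eval_part.comp ((Computable.ofNat _).comp Computable.snd)
        (Computable.const 0)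
  · intro c
    have : (Nat.rfind fun n => Part.some (decide (2 ^ n = 2 ^ Encodable.encode c))) =
        Part.some (Encodable.encode c) := by
      rw [Part.eq_some_iff]
      refine Nat.mem_rfind.2 ⟨by simp, fun {m} hm => ?_⟩
      have : (2:ℕ) ^ m ≠ 2 ^ Encodable.encode c := by
        intro h
        exact hm.ne (Nat.pow_right_injective le_rfl h)
      simp [this]
    simp only [this, Part.bind_some, Denumerable.ofNat_encode]

theorem exists_tm : ∃ (Γ Λ : Type) (_ : Inhabited Γ) (_ : Inhabited Λ) (_ : Finite Γ)
    (M : TM0.Machine Γ Λ) (S : Set Λ) (s0 s1 b : Γ), S.Finite ∧ TM0.Supports M S ∧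
    ∀ c : Nat.Partrec.Code, (StateTransition.eval (TM0.step M)
      (TM0.init (s0 :: s1 :: List.replicate (Encodable.encode c) b))).Dom ↔ (c.eval 0).Dom := by
  classical
  obtain ⟨f, hf, hfc⟩ := exists_partrec
  obtain ⟨c, hc⟩ := ToPartrec.Code.exists_code (Nat.Partrec'.part_iff₁.2 hf)
  let _ : Inhabited PartrecToTM2.Λ' := ⟨PartrecToTM2.trNormal c PartrecToTM2.Cont'.halt⟩
  have hS := PartrecToTM2.tr_supports c PartrecToTM2.Cont'.halt
  have hS1 := TM2to1.tr_supports _ hS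
  have hS0 := TM1to0.tr_supports _ hS1
  let sy : PartrecToTM2.Γ' → ∀ k : PartrecToTM2.K', Option PartrecToTM2.Γ' := fun a =>
    Function.update (fun _ => none) PartrecToTM2.K'.main (some a)
  refine ⟨TM2to1.Γ' PartrecToTM2.K' (fun _ => PartrecToTM2.Γ'), _, inferInstance, inferInstance,
    ?_, _, _, (true, sy .cons), (false, sy .bit1), (false, sy .bit0),
    Finset.finite_toSet _, hS0, ?_⟩
  · have : Finite PartrecToTM2.K' := Finite.of_surjective
      (fun i : Fin 4 => ![PartrecToTM2.K'.main, .rev, .aux, .stack] i)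
      (by
        intro k
        cases k
        exacts [⟨0, rfl⟩, ⟨1, rfl⟩, ⟨2, rfl⟩, ⟨3, rfl⟩])
    show Finite (Bool × (PartrecToTM2.K' → Option PartrecToTM2.Γ'))
    infer_instance
  · intro d
    have h1 := TM2to1.tr_eval_dom PartrecToTM2.tr PartrecToTM2.K'.main
      (PartrecToTM2.trList [2 ^ Encodable.encode d])
    rw [← TM1to0.tr_eval] at h1
    have h2 : TM2to1.trInit PartrecToTM2.K'.main (PartrecToTM2.trList [2 ^ Encodable.encode d]) =
        ((true, sy .cons) :: (false, sy .bit1) ::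
          List.replicate (Encodable.encode d) (false, sy .bit0) : List _) := by
      have hl : (PartrecToTM2.trList [2 ^ Encodable.encode d]).reverse =
          PartrecToTM2.Γ'.cons :: PartrecToTM2.Γ'.bit1 ::
            List.replicate (Encodable.encode d) PartrecToTM2.Γ'.bit0 := by
        simp [PartrecToTM2.trList, trNat_two_pow]
      unfold TM2to1.trInit
      rw [hl]
      have hm : ∀ m : ℕ, List.map (fun a => ((false, sy a) :
          TM2to1.Γ' PartrecToTM2.K' (fun _ => PartrecToTM2.Γ')))
          (List.replicate m PartrecToTM2.Γ'.bit0) = List.replicate m (false, sy .bit0) := by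
        intro m
        exact List.map_replicate
      rw [← hm]
      rfl
    rw [h2] at h1
    refine Iff.trans h1 ?_
    have h3 := PartrecToTM2.tr_eval c [2 ^ Encodable.encode d]
    have h4 := hc ⟨[2 ^ Encodable.encode d], rfl⟩
    simp only at h4
    rw [h4] at h3
    have h5 : PartrecToTM2.init c [2 ^ Encodable.encode d] =
      TM2.init PartrecToTM2.K'.main (PartrecToTM2.trList [2 ^ Encodable.encode d]) := by
      simp only [PartrecToTM2.init, TM2.init]
      congr 1
      funext k
      cases k <;> rfl
    rw [h5] at h3
    rw [← hfc]
    unfold TM2.eval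
    rw [h3]
    rfl

end Domino

namespace Domino

/-- Prime data: a prime with its square and cube. -/
def PD (p p2 p3 : ℤ) : Prop := (p = 2 ∧ p2 = 4 ∧ p3 = 8) ∨ (p = 3 ∧ p2 = 9 ∧ p3 = 27)

structure Cfg where
  f : ℤ → ℤ
  g : ℤ → ℤ
  D : ℤ → ℤ
  E : ℤ → ℤ
  h : ℤ → ℤ → ℤ
  v : ℤ → ℤ → ℤ
  τ : ℤ → ℤ → ℤ

def EvOK (p p2 p3 d q' t : ℤ) : Prop :=
  (¬ p ∣ q' ∧ t = -1 ∧ p2 ∣ q' - d) ∨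
  (p ∣ q' ∧ ¬ p2 ∣ q' ∧ t = 0 ∧ p3 ∣ q' - p * d) ∨
  (p2 ∣ q' ∧ ¬ p3 ∣ q' ∧ t = 1) ∨ (p3 ∣ q' ∧ t = 2)

def HalfOK (p p2 p3 f g d q q' t : ℤ) : Prop :=
  (¬ p ∣ g ∧ p3 ∣ q' - p * f ∧ EvOK p p2 p3 d q' t) ∨
  (p ∣ g ∧ ((t = -2 ∧ p3 ∣ q' - q) ∨ (p3 ∣ q' - q - 1 ∧ EvOK p p2 p3 d q' t)))

structure Valid (p p2 p3 : ℤ) (C : Cfg) : Prop where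
  fs : ∀ x, p2 ∣ C.f (x + 1) - C.f x - 1
  gs : ∀ x, p2 ∣ C.g (x + 1) - C.g x - 1
  ho : ∀ x y, HalfOK p p2 p3 (C.f x) (C.g y) (C.D x) (C.h (x - 1) y) (C.h x y) (C.τ x y)
  ve : ∀ x y, HalfOK p p2 p3 (C.g y) (C.f x) (C.E y) (C.v x (y - 1)) (C.v x y) (-C.τ x y)

def Cfg.tr (C : Cfg) : Cfg where
  f := C.g
  g := C.f
  D := C.E
  E := C.D
  h x y := C.v y x
  v x y := C.h y x
  τ x y := -C.τ y x

variable {p p2 p3 : ℤ} {C : Cfg}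

theorem Valid.tr (hC : Valid p p2 p3 C) : Valid p p2 p3 C.tr where
  fs := hC.gs
  gs := hC.fs
  ho x y := hC.ve y x
  ve x y := by
    have := hC.ho y x
    simpa [Cfg.tr] using this

theorem step_int {m : ℤ} {u : ℤ → ℤ} (hu : ∀ x, m ∣ u (x + 1) - u x - 1) (x k : ℤ) :
    m ∣ u (x + k) - u x - k := by
  induction k using Int.induction_on with
  | zero => simp
  | succ n ih =>
    have h1 := hu (x + n)
    obtain ⟨k, hk⟩ := h1
    obtain ⟨l, hl⟩ := ih
    refine ⟨k + l, ?_⟩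
    rw [← add_assoc]
    linear_combination hk + hl
  | pred n ih =>
    have h1 := hu (x + (-n - 1))
    rw [show x + (-(n:ℤ) - 1) + 1 = x + -n by ring] at h1
    obtain ⟨k, hk⟩ := h1
    obtain ⟨l, hl⟩ := ih
    exact ⟨l - k, by linear_combination hl - hk⟩

theorem exists_f (_hp : PD p p2 p3) {u : ℤ → ℤ} (hu : ∀ x, p2 ∣ u (x + 1) - u x - 1) (r : ℤ) :
    ∃ x, p2 ∣ u x - r := by
  refine ⟨r - u 0, ?_⟩
  have := step_int hu 0 (r - u 0)
  rw [zero_add] at this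
  convert this using 1
  ring

/-- zero rows -/
theorem Valid.D_zero (hp : PD p p2 p3) (hC : Valid p p2 p3 C) (x : ℤ) (hx : ¬ p ∣ C.f x) :
    p2 ∣ C.D x - C.f x := by
  obtain ⟨y, hy⟩ := exists_f hp hC.gs 1
  have := hC.ho x y
  unfold HalfOK EvOK at this
  rcases hp with ⟨rfl, rfl, rfl⟩ | ⟨rfl, rfl, rfl⟩ <;> omega

theorem Valid.tau_row0 (hp : PD p p2 p3) (hC : Valid p p2 p3 C) (x y : ℤ) (hy : ¬ p ∣ C.g y) :
    (¬ p ∣ C.f x ∧ C.τ x y = 0) ∨ (p ∣ C.f x ∧ ¬ p2 ∣ C.f x ∧ C.τ x y = 1) ∨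
      (p2 ∣ C.f x ∧ C.τ x y = 2) := by
  have := hC.ho x y
  unfold HalfOK EvOK at this
  rcases hp with ⟨rfl, rfl, rfl⟩ | ⟨rfl, rfl, rfl⟩ <;> omega

theorem Valid.tau_col0 (hp : PD p p2 p3) (hC : Valid p p2 p3 C) (x y : ℤ) (hx : ¬ p ∣ C.f x) :
    (¬ p ∣ C.g y ∧ C.τ x y = 0) ∨ (p ∣ C.g y ∧ ¬ p2 ∣ C.g y ∧ C.τ x y = -1) ∨
      (p2 ∣ C.g y ∧ C.τ x y = -2) := by
  have := hC.tr.tau_row0 hp y x hx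
  simp only [Cfg.tr] at this
  rcases hp with ⟨rfl, rfl, rfl⟩ | ⟨rfl, rfl, rfl⟩ <;> omega

/-- level one rows, zero columns -/
theorem Valid.row1_zero (hp : PD p p2 p3) (hC : Valid p p2 p3 C) (x y : ℤ) (hx : ¬ p ∣ C.f x)
    (hy : p ∣ C.g y) (hy' : ¬ p2 ∣ C.g y) :
    p2 ∣ C.h x y - C.f x ∧ p3 ∣ C.h x y - C.h (x - 1) y - 1 := by
  have h1 := hC.D_zero hp x hx
  have h2 := hC.tau_col0 hp x y hx
  have h3 := hC.ho x y
  unfold HalfOK EvOK at h3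
  rcases hp with ⟨rfl, rfl, rfl⟩ | ⟨rfl, rfl, rfl⟩ <;> omega

theorem Valid.row1 (hp : PD p p2 p3) (hC : Valid p p2 p3 C) (x y : ℤ)
    (hy : p ∣ C.g y) (hy' : ¬ p2 ∣ C.g y) :
    p2 ∣ C.h x y - C.f x ∧ p3 ∣ C.h x y - C.h (x - 1) y - 1 ∧
      EvOK p p2 p3 (C.D x) (C.h x y) (C.τ x y) := by
  have h3 := hC.ho x y
  have h2 := hC.tau_col0 hp x y
  by_cases hx : p ∣ C.f x
  · have f1 := hC.fs x
    have f2 := hC.fs (x - 1)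
    rw [sub_add_cancel] at f2
    have a1 : ¬ p ∣ C.f (x + 1) := by
      rcases hp with ⟨rfl, rfl, rfl⟩ | ⟨rfl, rfl, rfl⟩ <;> omega
    have a2 : ¬ p ∣ C.f (x - 1) := by
      rcases hp with ⟨rfl, rfl, rfl⟩ | ⟨rfl, rfl, rfl⟩ <;> omega
    have b1 := hC.row1_zero hp (x + 1) y a1 hy hy'
    have b2 := hC.row1_zero hp (x - 1) y a2 hy hy'
    rw [add_sub_cancel_right] at b1
    have c1 : p2 ∣ C.h x y - C.f x := by
      rcases hp with ⟨rfl, rfl, rfl⟩ | ⟨rfl, rfl, rfl⟩ <;> omega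
    unfold HalfOK at h3
    rcases h3 with h3 | ⟨-, h3 | h3⟩
    · exact absurd hy h3.1
    · exfalso
      rcases hp with ⟨rfl, rfl, rfl⟩ | ⟨rfl, rfl, rfl⟩ <;> omega
    · exact ⟨c1, h3⟩
  · have h1 := hC.row1_zero hp x y hx hy hy'
    refine ⟨h1.1, h1.2, ?_⟩
    unfold HalfOK at h3
    rcases h3 with h3 | ⟨-, h3 | h3⟩
    · exact absurd hy h3.1
    · exfalso
      have := h2 hx
      rcases hp with ⟨rfl, rfl, rfl⟩ | ⟨rfl, rfl, rfl⟩ <;> omega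
    · exact h3.2

theorem Valid.row1_sync (hp : PD p p2 p3) (hC : Valid p p2 p3 C) (x y y' : ℤ)
    (hy : p ∣ C.g y) (hy2 : ¬ p2 ∣ C.g y) (hy' : p ∣ C.g y') (hy2' : ¬ p2 ∣ C.g y') :
    p3 ∣ C.h x y - C.h x y' := by
  have key : ∀ x, p3 ∣ C.h (x + 1) y - C.h x y - 1 := by
    intro x
    have := (hC.row1 hp (x + 1) y hy hy2).2.1
    rwa [add_sub_cancel_right] at this
  have key' : ∀ x, p3 ∣ C.h (x + 1) y' - C.h x y' - 1 := by
    intro x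
    have := (hC.row1 hp (x + 1) y' hy' hy2').2.1
    rwa [add_sub_cancel_right] at this
  obtain ⟨z, hz⟩ := exists_f hp hC.fs p
  have k1 := step_int (u := fun x => C.h x y) key x (z - x)
  have k2 := step_int (u := fun x => C.h x y') key' x (z - x)
  simp only [add_sub_cancel] at k1 k2
  have h1 := hC.row1 hp z y hy hy2
  have h2 := hC.row1 hp z y' hy' hy2'
  unfold EvOK at h1 h2
  rcases hp with ⟨rfl, rfl, rfl⟩ | ⟨rfl, rfl, rfl⟩ <;> omega

theorem Valid.row2 (hp : PD p p2 p3) (hC : Valid p p2 p3 C) (x y : ℤ) (hx : ¬ p ∣ C.f x)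
    (hy : p2 ∣ C.g y) : p3 ∣ C.h x y - C.h (x - 1) y := by
  have h2 := hC.tau_col0 hp x y hx
  have h3 := hC.ho x y
  unfold HalfOK EvOK at h3
  rcases hp with ⟨rfl, rfl, rfl⟩ | ⟨rfl, rfl, rfl⟩ <;> omega

theorem Valid.row2' (hp : PD p p2 p3) (hC : Valid p p2 p3 C) (x y : ℤ) (hx : p ∣ C.f x)
    (hy : p2 ∣ C.g y) : p3 ∣ C.h (x - 1) y - C.h (x - p) y := by
  have f1 := hC.fs (x - 1)
  have f2 := hC.fs (x - 2)
  have h1 := fun hx => hC.row2 hp (x - 1) y hx hy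
  rw [sub_add_cancel] at f1
  rw [show x - 2 + 1 = x - 1 by ring] at f2
  rw [show x - 1 - 1 = x - 2 by ring] at h1
  rcases hp with ⟨rfl, rfl, rfl⟩ | ⟨rfl, rfl, rfl⟩
  · exact h1 (by omega)
  · have h2 := hC.row2 (.inr ⟨rfl, rfl, rfl⟩) (x - 2) y (by omega) hy
    rw [show x - 2 - 1 = x - 3 by ring] at h2
    have := h1 (by omega)
    omega

/-- derived phases -/
theorem Valid.exists_F (hp : PD p p2 p3) (hC : Valid p p2 p3 C) : ∃ F : ℤ → ℤ,
    (∀ x, p3 ∣ F (x + 1) - F x - 1) ∧ (∀ x, p2 ∣ F x - C.f x) ∧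
    ∀ x y, p ∣ C.g y → ¬ p2 ∣ C.g y → p3 ∣ C.h x y - F x := by
  obtain ⟨y, hy⟩ := exists_f hp hC.gs p
  have hy1 : p ∣ C.g y := by
    rcases hp with ⟨rfl, rfl, rfl⟩ | ⟨rfl, rfl, rfl⟩ <;> omega
  have hy2 : ¬ p2 ∣ C.g y := by
    rcases hp with ⟨rfl, rfl, rfl⟩ | ⟨rfl, rfl, rfl⟩ <;> omega
  refine ⟨fun x => C.h x y, ?_, ?_, ?_⟩
  · intro x
    have := (hC.row1 hp (x + 1) y hy1 hy2).2.1
    rwa [add_sub_cancel_right] at this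
  · intro x
    exact (hC.row1 hp x y hy1 hy2).1
  · intro x y' h1 h2
    exact hC.row1_sync hp x y' y h1 h2 hy1 hy2

def Cfg.sub (p x0 y0 : ℤ) (F G : ℤ → ℤ) (C : Cfg) : Cfg where
  f m := F (x0 + p * m) / p
  g m := G (y0 + p * m) / p
  D m := C.D (x0 + p * m)
  E m := C.E (y0 + p * m)
  h m n := C.h (x0 + p * m) (y0 + p * n)
  v m n := C.v (x0 + p * m) (y0 + p * n)
  τ m n := C.τ (x0 + p * m) (y0 + p * n)

theorem f_mul (hp : PD p p2 p3) {u : ℤ → ℤ} (hu : ∀ x, p2 ∣ u (x + 1) - u x - 1) {x0 : ℤ}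
    (h0 : p ∣ u x0) (m : ℤ) : p ∣ u (x0 + p * m) := by
  have := step_int hu x0 (p * m)
  rcases hp with ⟨rfl, rfl, rfl⟩ | ⟨rfl, rfl, rfl⟩ <;> omega

theorem sub_half (hp : PD p p2 p3) (hC : Valid p p2 p3 C) {x0 y0 : ℤ} {F G : ℤ → ℤ}
    (hx0 : p ∣ C.f x0) (hy0 : p ∣ C.g y0)
    (hF2 : ∀ x, p2 ∣ F x - C.f x)
    (hF3 : ∀ x y, p ∣ C.g y → ¬ p2 ∣ C.g y → p3 ∣ C.h x y - F x)
    (hG2 : ∀ x, p2 ∣ G x - C.g x) (m n : ℤ) :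
    HalfOK p p2 p3 (F (x0 + p * m) / p) (G (y0 + p * n) / p) (C.D (x0 + p * m))
      (C.h (x0 + p * (m - 1)) (y0 + p * n)) (C.h (x0 + p * m) (y0 + p * n))
      (C.τ (x0 + p * m) (y0 + p * n)) := by
  have hx := f_mul hp hC.fs hx0 m
  have hy := f_mul hp hC.gs hy0 n
  rw [show x0 + p * (m - 1) = x0 + p * m - p by ring]
  generalize x0 + p * m = x at *
  generalize y0 + p * n = y at *
  have a1 := hF2 x
  have a2 := hG2 y
  by_cases h : p2 ∣ C.g y
  · have h1 := hC.row2' hp x y hx h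
    have h2 := hC.ho x y
    unfold HalfOK at h2 ⊢
    right
    refine ⟨?_, ?_⟩
    · rcases hp with ⟨rfl, rfl, rfl⟩ | ⟨rfl, rfl, rfl⟩ <;> omega
    · rcases h2 with h2 | ⟨-, h2 | h2⟩
      · exact absurd hy h2.1
      · left
        rcases hp with ⟨rfl, rfl, rfl⟩ | ⟨rfl, rfl, rfl⟩ <;> omega
      · right
        refine ⟨?_, h2.2⟩
        rcases hp with ⟨rfl, rfl, rfl⟩ | ⟨rfl, rfl, rfl⟩ <;> omega
  · have h1 := hF3 x y hy h
    have h2 := hC.row1 hp x y hy h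
    left
    refine ⟨?_, ?_, h2.2.2⟩
    · rcases hp with ⟨rfl, rfl, rfl⟩ | ⟨rfl, rfl, rfl⟩ <;> omega
    · rcases hp with ⟨rfl, rfl, rfl⟩ | ⟨rfl, rfl, rfl⟩ <;> omega

theorem Valid.derive (hp : PD p p2 p3) (hC : Valid p p2 p3 C) : ∃ (x0 y0 : ℤ) (C' : Cfg),
    Valid p p2 p3 C' ∧ (∀ m, p ∣ C.f (x0 + p * m)) ∧ (∀ m, p ∣ C.g (y0 + p * m)) ∧
    (∀ m, p ∣ C'.f m ↔ p2 ∣ C.f (x0 + p * m)) ∧ (∀ m, p ∣ C'.g m ↔ p2 ∣ C.g (y0 + p * m)) ∧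
    (∀ m n, C'.τ m n = C.τ (x0 + p * m) (y0 + p * n)) := by
  obtain ⟨F, hF1, hF2, hF3⟩ := hC.exists_F hp
  obtain ⟨G, hG1, hG2, hG3⟩ := hC.tr.exists_F hp
  obtain ⟨x0, hx0⟩ := exists_f hp hC.fs 0
  obtain ⟨y0, hy0⟩ := exists_f hp hC.gs 0
  have hx : p ∣ C.f x0 := by
    rcases hp with ⟨rfl, rfl, rfl⟩ | ⟨rfl, rfl, rfl⟩ <;> omega
  have hy : p ∣ C.g y0 := by
    rcases hp with ⟨rfl, rfl, rfl⟩ | ⟨rfl, rfl, rfl⟩ <;> omega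
  have hxm := f_mul hp hC.fs hx
  have hym := f_mul hp hC.gs hy
  refine ⟨x0, y0, C.sub p x0 y0 F G, ⟨?_, ?_, ?_, ?_⟩, hxm, hym, ?_, ?_, fun _ _ => rfl⟩
  · intro m
    have h1 := step_int hF1 (x0 + p * m) p
    rw [show x0 + p * m + p = x0 + p * (m + 1) by ring] at h1
    have h2 := hF2 (x0 + p * m)
    have h3 := hxm m
    simp only [Cfg.sub]
    rcases hp with ⟨rfl, rfl, rfl⟩ | ⟨rfl, rfl, rfl⟩ <;> omega
  · intro m
    have h1 := step_int hG1 (y0 + p * m) p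
    rw [show y0 + p * m + p = y0 + p * (m + 1) by ring] at h1
    have h2 := hG2 (y0 + p * m)
    have h3 := hym m
    simp only [Cfg.sub, Cfg.tr] at h2 ⊢
    rcases hp with ⟨rfl, rfl, rfl⟩ | ⟨rfl, rfl, rfl⟩ <;> omega
  · intro m n
    exact sub_half hp hC hx hy hF2 hF3 hG2 m n
  · intro m n
    exact sub_half hp hC.tr hy hx hG2 hG3 hF2 n m
  · intro m
    have h2 := hF2 (x0 + p * m)
    have h3 := hxm m
    simp only [Cfg.sub]
    rcases hp with ⟨rfl, rfl, rfl⟩ | ⟨rfl, rfl, rfl⟩ <;> omega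
  · intro m
    have h2 := hG2 (y0 + p * m)
    have h3 := hym m
    simp only [Cfg.sub, Cfg.tr] at h2 ⊢
    rcases hp with ⟨rfl, rfl, rfl⟩ | ⟨rfl, rfl, rfl⟩ <;> omega

theorem exists_hier (hp : PD p p2 p3) : ∃ a b : ℕ → {C : Cfg // Valid p p2 p3 C} → ℤ,
    (∀ C x, p ∣ x - a 0 C → ¬ p ∣ C.1.f x) ∧ (∀ C y, p ∣ y - b 0 C → ¬ p ∣ C.1.g y) ∧
    ∀ C, ∃ x0 y0 C', (∀ i, a (i + 1) C = x0 + p * a i C') ∧ (∀ i, b (i + 1) C = y0 + p * b i C') ∧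
    (∀ m, p ∣ C.1.f (x0 + p * m)) ∧ (∀ m, p ∣ C.1.g (y0 + p * m)) ∧
    (∀ m, p ∣ C'.1.f m ↔ p2 ∣ C.1.f (x0 + p * m)) ∧
    (∀ m, p ∣ C'.1.g m ↔ p2 ∣ C.1.g (y0 + p * m)) ∧
    (∀ m n, C'.1.τ m n = C.1.τ (x0 + p * m) (y0 + p * n)) := by
  have H := fun C : {C : Cfg // Valid p p2 p3 C} => C.2.derive hp
  choose x0 y0 C' hC' h1 h2 h3 h4 h5 using H
  have Z := fun C : {C : Cfg // Valid p p2 p3 C} => exists_f hp C.2.fs 1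
  have Z' := fun C : {C : Cfg // Valid p p2 p3 C} => exists_f hp C.2.gs 1
  choose z hz using Z
  choose z' hz' using Z'
  refine ⟨fun i => Nat.rec z (fun _ r C => x0 C + p * r ⟨C' C, hC' C⟩) i,
    fun i => Nat.rec z' (fun _ r C => y0 C + p * r ⟨C' C, hC' C⟩) i, ?_, ?_, ?_⟩
  · intro C x hx
    have := step_int C.2.fs (z C) (x - z C)
    rw [add_sub_cancel] at this
    have := hz C
    change p ∣ x - z C at hx
    rcases hp with ⟨rfl, rfl, rfl⟩ | ⟨rfl, rfl, rfl⟩ <;> omega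
  · intro C x hx
    have := step_int C.2.gs (z' C) (x - z' C)
    rw [add_sub_cancel] at this
    have := hz' C
    change p ∣ x - z' C at hx
    rcases hp with ⟨rfl, rfl, rfl⟩ | ⟨rfl, rfl, rfl⟩ <;> omega
  · intro C
    exact ⟨x0 C, y0 C, ⟨C' C, hC' C⟩, fun _ => rfl, fun _ => rfl, h1 C, h2 C, h3 C, h4 C, h5 C⟩

theorem descend (_hp : PD p p2 p3) {x x0 a : ℤ} {i : ℕ} (h : p ^ (i + 1 + 1) ∣ x - (x0 + p * a)) :
    ∃ m, x = x0 + p * m ∧ p ^ (i + 1) ∣ m - a := by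
  obtain ⟨k, hk⟩ := h
  refine ⟨a + p ^ (i + 1) * k, ?_, ⟨k, by ring⟩⟩
  rw [pow_succ] at hk
  linear_combination hk

theorem force (hp : PD p p2 p3) (hC : Valid p p2 p3 C) : ∃ a b : ℕ → ℤ, ∀ (i j : ℕ) (x y : ℤ),
    p ^ (i + 1) ∣ x - a i → p ^ (j + 1) ∣ y - b j →
    (p ∣ C.f x ↔ i ≠ 0) ∧ (p ∣ C.g y ↔ j ≠ 0) ∧ 
    (i = j → C.τ x y = 0) ∧ (i = j + 1 → C.τ x y = 1) ∧ (j = i + 1 → C.τ x y = -1) := by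
  obtain ⟨a, b, ha, hb, H⟩ := exists_hier hp
  refine ⟨fun i => a i ⟨C, hC⟩, fun i => b i ⟨C, hC⟩, ?_⟩
  have key : ∀ (i j : ℕ) (C : {C : Cfg // Valid p p2 p3 C}) (x y : ℤ),
    p ^ (i + 1) ∣ x - a i C → p ^ (j + 1) ∣ y - b j C →
    (p ∣ C.1.f x ↔ i ≠ 0) ∧ (p ∣ C.1.g y ↔ j ≠ 0) ∧ 
    (i = j → C.1.τ x y = 0) ∧ (i = j + 1 → C.1.τ x y = 1) ∧ (j = i + 1 → C.1.τ x y = -1) := by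
    intro i
    induction i with
    | zero =>
      intro j C x y hx hy
      rw [zero_add, pow_one] at hx
      have hfx := ha C x hx
      have ht := C.2.tau_col0 hp x y hfx
      rcases j with _ | j
      · rw [zero_add, pow_one] at hy
        have hgy := hb C y hy
        simp only [hfx, hgy]
        rcases ht with ht | ht | ht
        · simp [ht]
        · exact absurd ht.1 hgy
        · exact absurd (by rcases hp with ⟨rfl, rfl, rfl⟩ | ⟨rfl, rfl, rfl⟩ <;> omega) hgy
      · obtain ⟨x0, y0, C', h1, h2, h3, h4, h5, h6, h7⟩ := H C
        rw [h2] at hy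
        obtain ⟨n, rfl, hn⟩ := descend hp hy
        simp only [hfx, h4 n]
        refine ⟨by simp, by simp, by simp, by simp, ?_⟩
        intro hj
        obtain rfl : j = 0 := by omega
        rw [zero_add, pow_one] at hn
        have := hb C' n hn
        rw [h6] at this
        rcases ht with ht | ht | ht
        · exact absurd (h4 n) ht.1
        · exact ht.2.2
        · exact absurd ht.1 this
    | succ i ih =>
      intro j C x y hx hy
      obtain ⟨x0, y0, C', h1, h2, h3, h4, h5, h6, h7⟩ := H C
      rw [h1] at hx
      obtain ⟨m, rfl, hm⟩ := descend hp hx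
      rcases j with _ | j
      · rw [zero_add, pow_one] at hy
        have hgy := hb C y hy
        have ht := C.2.tau_row0 hp (x0 + p * m) y hgy
        simp only [hgy, h3 m]
        refine ⟨by simp, by simp, by simp, ?_, by simp⟩
        intro hj
        obtain rfl : i = 0 := by omega
        rw [zero_add, pow_one] at hm
        have := ha C' m hm
        rw [h5] at this
        rcases ht with ht | ht | ht
        · exact absurd (h3 m) ht.1
        · exact ht.2.2
        · exact absurd ht.1 this
      · rw [h2] at hy
        obtain ⟨n, rfl, hn⟩ := descend hp hy
        have := ih j C' m n hm hn
        rw [h7] at this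
        refine ⟨by simp [h3 m], by simp [h4 n], ?_, ?_, ?_⟩
        · intro h; exact this.2.2.1 (by omega)
        · intro h; exact this.2.2.2.1 (by omega)
        · intro h; exact this.2.2.2.2 (by omega)
  intro i j x y
  exact key i j ⟨C, hC⟩ x y


/-! existence of hierarchical configurations -/

noncomputable def lev (p x : ℤ) : ℕ := multiplicity p x

theorem PD.two_le (hp : PD p p2 p3) : 2 ≤ p := by
  rcases hp with ⟨rfl, rfl, rfl⟩ | ⟨rfl, rfl, rfl⟩ <;> omega

theorem lev_spec (hp : PD p p2 p3) {x : ℤ} (hx : x ≠ 0) : ∃ d, x = p ^ lev p x * d ∧ ¬ p ∣ d := by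
  have h2 := hp.two_le
  have hf : FiniteMultiplicity p x := by
    rw [Int.finiteMultiplicity_iff]
    exact ⟨by omega, hx⟩
  exact hf.exists_eq_pow_mul_and_not_dvd

def clamp (t : ℤ) : ℤ := max (-2) (min 2 t)

noncomputable def hDef (p x y : ℤ) : ℤ :=
  if y = 0 then (if x < 0 then p - 1 else p)
  else if lev p y = 0 then p * x else x / p ^ (lev p y - 1)

noncomputable def tDef (p x y : ℤ) : ℤ :=
  if y = 0 then (if x = 0 then 0 else -2)
  else if x = 0 then 2 else clamp (lev p x - lev p y)

noncomputable def dDef (p x : ℤ) : ℤ := if x = 0 then 1 else x / p ^ lev p x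

noncomputable def baseCfg (p : ℤ) : Cfg where
  f x := x
  g x := x
  D x := dDef p x
  E x := dDef p x
  h x y := hDef p x y
  v x y := hDef p y x
  τ x y := tDef p x y

theorem div_pred_of_not_dvd {P x : ℤ} (hP : 0 < P) (h : ¬ P ∣ x) : x / P = (x - 1) / P := by
  have h1 := Int.emod_add_mul_ediv x P
  have h2 := Int.emod_nonneg x hP.ne'
  have h3 := Int.emod_lt_of_pos x hP
  have h4 : x % P ≠ 0 := fun h' => h (Int.dvd_of_emod_eq_zero h')
  symm
  exact ((Int.ediv_emod_unique (r := x % P - 1) hP).2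
    ⟨by linear_combination h1, by omega, by omega⟩).1

theorem div_pred_of_mul {P q : ℤ} (hP : 0 < P) : (P * q - 1) / P = q - 1 :=
  ((Int.ediv_emod_unique (r := P - 1) hP).2
    ⟨by ring, by omega, by omega⟩).1

theorem hDef_half (hp : PD p p2 p3) (x y : ℤ) :
    HalfOK p p2 p3 x y (dDef p x) (hDef p (x - 1) y) (hDef p x y) (tDef p x y) := by
  have h2 := hp.two_le
  by_cases hy : y = 0
  · subst hy
    simp only [hDef, tDef, dDef, if_true]
    unfold HalfOK EvOK
    by_cases hx : x = 0
    · subst hx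
      rcases hp with ⟨rfl, rfl, rfl⟩ | ⟨rfl, rfl, rfl⟩ <;> norm_num
    · have : (if x < 0 then p - 1 else p) = if x - 1 < 0 then p - 1 else p := by
        split_ifs <;> omega
      simp [hx, this]
  obtain ⟨e, hye, he⟩ := lev_spec hp hy
  have hyd : p ∣ y ↔ lev p y ≠ 0 := by
    constructor
    · intro h h0
      rw [h0, pow_zero, one_mul] at hye
      exact he (hye ▸ h)
    · intro h
      rw [hye]
      exact (dvd_pow_self p h).mul_right _
  simp only [hDef, tDef, hy, if_false]
  rcases hk : lev p y with _ | k
  · left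
    simp only [hk] at hyd
    refine ⟨by simpa using hyd, by simp, ?_⟩
    by_cases hx : x = 0
    · subst hx; simp [EvOK]
    · obtain ⟨d, hxd, hd⟩ := lev_spec hp hx
      simp only [hx, if_false, if_true, dDef]
      unfold EvOK clamp
      rcases hi : lev p x with _ | _ | i
      · rcases hp with ⟨rfl, rfl, rfl⟩ | ⟨rfl, rfl, rfl⟩ <;> simp [hi] at hxd ⊢ <;> omega
      · rcases hp with ⟨rfl, rfl, rfl⟩ | ⟨rfl, rfl, rfl⟩ <;> simp [hi] at hxd ⊢ <;> omega
      · rw [hi] at hxd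
        have : x = p * (p * (p ^ i * d)) := by rw [hxd]; ring
        generalize p ^ i * d = z at this
        rcases hp with ⟨rfl, rfl, rfl⟩ | ⟨rfl, rfl, rfl⟩ <;> simp <;> omega
  · right
    refine ⟨by rw [hyd, hk]; omega, ?_⟩
    simp only [Nat.add_eq_zero_iff, one_ne_zero, and_false, if_false, Nat.add_sub_cancel]
    have hP : 0 < p ^ k := by positivity
    by_cases hx : x = 0
    · subst hx
      right
      have := div_pred_of_mul (q := 0) hP
      rw [mul_zero] at this
      rw [this]
      simp [EvOK]
    obtain ⟨d, hxd, hd⟩ := lev_spec hp hx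
    simp only [hx, if_false]
    by_cases hik : lev p x < k
    · left
      constructor
      · simp [clamp]; omega
      · rw [div_pred_of_not_dvd hP, sub_self]
        · exact dvd_zero _
        · intro h
          apply hd
          have h1 : p ^ (lev p x + 1) ∣ p ^ lev p x * d := by
            rw [← hxd]
            exact (pow_dvd_pow p hik).trans h
          rw [pow_succ] at h1
          exact (mul_dvd_mul_iff_left (by positivity)).1 h1
    · right
      obtain ⟨i, hi⟩ := Nat.exists_eq_add_of_le (not_lt.1 hik)
      have hq : x = p ^ k * (p ^ i * d) := by rw [hxd, hi]; ring
      have hdd : dDef p x = d := by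
        simp only [dDef, hx, if_false]
        rw [Int.ediv_eq_of_eq_mul_right (by positivity) hxd]
      rw [hdd, hi]
      have e1 : x / p ^ k = p ^ i * d := by
        rw [Int.ediv_eq_of_eq_mul_right hP.ne' hq]
      have e2 : (x - 1) / p ^ k = p ^ i * d - 1 := by
        rw [hq]
        exact div_pred_of_mul hP
      rw [e1, e2]
      refine ⟨by simp, ?_⟩
      clear e1 e2 hq hxd hdd hi hik hk hyd hye
      unfold EvOK clamp
      rcases i with _ | _ | _ | i
      · left
        simp [hd]
      · right; left
        rcases hp with ⟨rfl, rfl, rfl⟩ | ⟨rfl, rfl, rfl⟩ <;> simp <;> omega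
      · right; right; left
        rcases hp with ⟨rfl, rfl, rfl⟩ | ⟨rfl, rfl, rfl⟩ <;> simp <;> omega
      · right; right; right
        have : p ^ (i + 1 + 1 + 1) * d = p * (p * (p * (p ^ i * d))) := by ring
        rw [this]
        generalize p ^ i * d = z
        rcases hp with ⟨rfl, rfl, rfl⟩ | ⟨rfl, rfl, rfl⟩ <;> simp <;> omega

theorem tDef_swap (p x y : ℤ) : tDef p y x = -tDef p x y := by
  unfold tDef clamp
  split_ifs <;> omega

theorem baseCfg_valid (hp : PD p p2 p3) : Valid p p2 p3 (baseCfg p) where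
  fs x := by simp [baseCfg]
  gs x := by simp [baseCfg]
  ho x y := hDef_half hp x y
  ve x y := by
    have := hDef_half hp y x
    rw [tDef_swap] at this
    exact this

def Cfg.red (p2 p3 : ℤ) (C : Cfg) : Cfg where
  f x := C.f x % p2
  g x := C.g x % p2
  D x := C.D x % p2
  E x := C.E x % p2
  h x y := C.h x y % p3
  v x y := C.v x y % p3
  τ := C.τ

theorem HalfOK.red (hp : PD p p2 p3) {f g d q q' t : ℤ} (h : HalfOK p p2 p3 f g d q q' t) :
    HalfOK p p2 p3 (f % p2) (g % p2) (d % p2) (q % p3) (q' % p3) t := by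
  unfold HalfOK EvOK at *
  rcases hp with ⟨rfl, rfl, rfl⟩ | ⟨rfl, rfl, rfl⟩
  · rcases h with h | ⟨h1, h | h⟩
    · left
      refine ⟨by omega, by omega, ?_⟩
      omega
    · right; omega
    · right
      refine ⟨by omega, ?_⟩
      right
      refine ⟨by omega, ?_⟩
      omega
  · rcases h with h | ⟨h1, h | h⟩
    · left
      refine ⟨by omega, by omega, ?_⟩
      omega
    · right; omega
    · right
      refine ⟨by omega, ?_⟩
      right
      refine ⟨by omega, ?_⟩
      omega

theorem Valid.red (hp : PD p p2 p3) (hC : Valid p p2 p3 C) : Valid p p2 p3 (C.red p2 p3) where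
  fs x := by
    have := hC.fs x
    simp only [Cfg.red]
    rcases hp with ⟨rfl, rfl, rfl⟩ | ⟨rfl, rfl, rfl⟩ <;> omega
  gs x := by
    have := hC.gs x
    simp only [Cfg.red]
    rcases hp with ⟨rfl, rfl, rfl⟩ | ⟨rfl, rfl, rfl⟩ <;> omega
  ho x y := (hC.ho x y).red hp
  ve x y := (hC.ve x y).red hp

structure Bounded (p2 p3 : ℤ) (C : Cfg) : Prop where
  f : ∀ x, 0 ≤ C.f x ∧ C.f x < p2
  g : ∀ x, 0 ≤ C.g x ∧ C.g x < p2
  D : ∀ x, 0 ≤ C.D x ∧ C.D x < p2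
  E : ∀ x, 0 ≤ C.E x ∧ C.E x < p2
  h : ∀ x y, 0 ≤ C.h x y ∧ C.h x y < p3
  v : ∀ x y, 0 ≤ C.v x y ∧ C.v x y < p3

theorem exists_cfg (hp : PD p p2 p3) : ∃ C : Cfg, Valid p p2 p3 C ∧ Bounded p2 p3 C ∧
    (∀ x, x ≠ 0 → (p ∣ C.g x ↔ lev p x ≠ 0)) ∧ p ∣ C.g 0 ∧
    (∀ x y, x ≠ 0 → y ≠ 0 → -1 ≤ C.τ x y → C.τ x y ≤ 1 → C.τ x y = lev p x - lev p y) ∧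
    (∀ x, x ≠ 0 → C.τ x 0 = -2) ∧ (∀ y, y ≠ 0 → C.τ 0 y = 2) ∧ C.τ 0 0 = 0 := by
  have hpp : 0 < p2 ∧ 0 < p3 := by
    rcases hp with ⟨rfl, rfl, rfl⟩ | ⟨rfl, rfl, rfl⟩ <;> omega
  have e : ∀ x, 0 ≤ x % p2 ∧ x % p2 < p2 := fun x =>
    ⟨Int.emod_nonneg _ hpp.1.ne', Int.emod_lt_of_pos _ hpp.1⟩
  have e' : ∀ x, 0 ≤ x % p3 ∧ x % p3 < p3 := fun x =>
    ⟨Int.emod_nonneg _ hpp.2.ne', Int.emod_lt_of_pos _ hpp.2⟩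
  refine ⟨(baseCfg p).red p2 p3, (baseCfg_valid hp).red hp,
    ⟨fun _ => e _, fun _ => e _, fun _ => e _, fun _ => e _, fun _ _ => e' _, fun _ _ => e' _⟩,
    ?_, ?_, ?_, ?_, ?_, ?_⟩
  · intro x hx
    obtain ⟨d, hxd, hd⟩ := lev_spec hp hx
    have : p ∣ ((baseCfg p).red p2 p3).g x ↔ p ∣ x := by
      simp only [Cfg.red, baseCfg]
      rcases hp with ⟨rfl, rfl, rfl⟩ | ⟨rfl, rfl, rfl⟩ <;> omega
    rw [this]
    constructor
    · intro h h0
      rw [h0, pow_zero, one_mul] at hxd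
      exact hd (hxd ▸ h)
    · intro h
      rw [hxd]
      exact (dvd_pow_self p h).mul_right _
  · simp [Cfg.red, baseCfg]
  · intro x y hx hy
    simp only [Cfg.red, baseCfg, tDef, clamp, hx, hy, if_false]
    omega
  · intro x hx
    simp [Cfg.red, baseCfg, tDef, hx]
  · intro x hx
    simp [Cfg.red, baseCfg, tDef, hx]
  · simp [Cfg.red, baseCfg, tDef]

end Domino

namespace Domino

/-! tile sets -/

abbrev Q : Type := Fin 27 × Fin 27 × Fin 27 × Fin 27
abbrev Kap : Type := Option (Fin 3 × Fin 3 × Bool × Bool)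

def fz (a : Fin 27) : ℤ := (a.val : ℤ)
def zf (z : ℤ) : Fin 27 := ⟨z.toNat % 27, Nat.mod_lt _ (by norm_num)⟩
def ft (a : Fin 5) : ℤ := (a.val : ℤ) - 2
def tf (z : ℤ) : Fin 5 := ⟨(z + 2).toNat % 5, Nat.mod_lt _ (by norm_num)⟩
def z3 (z : ℤ) : Fin 3 := ⟨(z + 1).toNat % 3, Nat.mod_lt _ (by norm_num)⟩

theorem fz_zf {z : ℤ} (h0 : 0 ≤ z) (h1 : z < 27) : fz (zf z) = z := by
  simp only [fz, zf]
  omega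

theorem ft_tf {z : ℤ} (h0 : -2 ≤ z) (h1 : z ≤ 2) : ft (tf z) = z := by
  simp only [ft, tf]
  omega

theorem z3_eq {z : ℤ} {a : Fin 3} (h : z + 1 = (a.val : ℤ)) : z3 z = a := by
  apply Fin.ext
  have := a.isLt
  simp only [z3]
  omega

def LT (p p2 p3 : ℤ) (W S E N : Q) (t : ℤ) : Prop :=
  (E.1 = W.1 ∧ E.2.2.1 = W.2.2.1 ∧ N.1 = S.1 ∧ N.2.2.1 = S.2.2.1 ∧ E.2.1 = N.1 ∧ N.2.1 = E.1) ∧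
  p2 ∣ fz E.2.1 - fz W.2.1 - 1 ∧ p2 ∣ fz N.2.1 - fz S.2.1 - 1 ∧
  HalfOK p p2 p3 (fz E.2.1) (fz E.1) (fz N.2.2.1) (fz W.2.2.2) (fz E.2.2.2) t ∧
  HalfOK p p2 p3 (fz E.1) (fz E.2.1) (fz E.2.2.1) (fz S.2.2.2) (fz N.2.2.2) (-t)

structure HT where
  W : Q × Q
  S : Q × Q
  E : Q × Q
  N : Q × Q
  t2 : Fin 5
  t3 : Fin 5

def HT.OK (k : HT) : Prop :=
  LT 2 4 8 k.W.1 k.S.1 k.E.1 k.N.1 (ft k.t2) ∧ LT 3 9 27 k.W.2 k.S.2 k.E.2 k.N.2 (ft k.t3)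

def kap (t2 t3 : ℤ) (zi zj : Bool) : Kap :=
  if -1 ≤ t2 ∧ t2 ≤ 1 ∧ -1 ≤ t3 ∧ t3 ≤ 1 then some (z3 t2, z3 t3, zi, zj) else none

def HT.kap (k : HT) : Kap :=
  Domino.kap (ft k.t2) (ft k.t3) (decide (¬ (2:ℤ) ∣ fz k.E.1.1)) (decide (¬ (3:ℤ) ∣ fz k.E.2.1))

def HT.out (k : HT) : (ℕ × ℕ × ℕ × ℕ) × Kap :=
  ((Encodable.encode k.W, Encodable.encode k.S, Encodable.encode k.E, Encodable.encode k.N), k.kap)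

theorem exists_G : ∃ G : List ((ℕ × ℕ × ℕ × ℕ) × Kap), ∀ z, z ∈ G ↔ ∃ k : HT, k.OK ∧ k.out = z := by
  have : Finite HT := Finite.of_injective
    (fun k : HT => (k.W, k.S, k.E, k.N, k.t2, k.t3)) (by
      rintro ⟨⟩ ⟨⟩ h
      simpa using h)
  have hf : Set.Finite {z | ∃ k : HT, k.OK ∧ k.out = z} :=
    (Set.toFinite {k : HT | k.OK}).image HT.out
  refine ⟨hf.toFinset.toList, fun z => ?_⟩
  simp

section
variable {Lb : Type} [Encodable Lb]

def mk (z : (ℕ × ℕ × ℕ × ℕ) × Kap) (r c : Lb) : WangTile :=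
  (Nat.pair z.1.1 (Encodable.encode r), Nat.pair z.1.2.1 (Encodable.encode c),
    Nat.pair z.1.2.2.1 (Encodable.encode r), Nat.pair z.1.2.2.2 (Encodable.encode c))

def tiles (G : List ((ℕ × ℕ × ℕ × ℕ) × Kap)) (lab : List Lb) (R : Kap → Lb → Lb → Bool) :
    List WangTile :=
  G.flatMap fun z => lab.flatMap fun r => lab.flatMap fun c =>
    if R z.2 r c then [mk z r c] else []

theorem mem_tiles {G : List ((ℕ × ℕ × ℕ × ℕ) × Kap)} {lab : List Lb} {R : Kap → Lb → Lb → Bool}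
    {w : WangTile} : w ∈ tiles G lab R ↔
      ∃ z ∈ G, ∃ r ∈ lab, ∃ c ∈ lab, R z.2 r c = true ∧ w = mk z r c := by
  simp only [tiles, List.mem_flatMap]
  constructor
  · rintro ⟨z, hz, r, hr, c, hc, h⟩
    refine ⟨z, hz, r, hr, c, hc, ?_⟩
    split_ifs at h with h1
    · exact ⟨h1, by simpa using h⟩
    · simp at h
  · rintro ⟨z, hz, r, hr, c, hc, h1, h⟩
    refine ⟨z, hz, r, hr, c, hc, ?_⟩
    rw [if_pos h1]
    simpa using h

def Sol (lab : List Lb) (R : Kap → Lb → Lb → Bool) : Prop :=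
  ∃ t : ℕ → ℕ → Lb, (∀ i j, t i j ∈ lab) ∧ ∀ (i j i' j' : ℕ) (a b : Fin 3),
    i' + 1 = i + a.val → j' + 1 = j + b.val →
    R (some (a, b, decide (i = 0), decide (j = 0))) (t i j) (t i' j') = true

theorem const_int {α : Type} {u : ℤ → α} (h : ∀ y, u (y + 1) = u y) (y : ℤ) : u y = u 0 := by
  induction y using Int.induction_on with
  | zero => rfl
  | succ n ih => rw [h, ih]
  | pred n ih => rw [← ih, ← h (-n - 1), sub_add_cancel]

theorem extract {p p2 p3 : ℤ} {W S E N : ℤ → ℤ → Q} {τ : ℤ → ℤ → ℤ}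
    (hOK : ∀ x y, LT p p2 p3 (W x y) (S x y) (E x y) (N x y) (τ x y))
    (hE : ∀ x y, E x y = W (x + 1) y) (hN : ∀ x y, N x y = S x (y + 1)) :
    Valid p p2 p3 ⟨fun x => fz (N x 0).1, fun y => fz (E 0 y).1, fun x => fz (N x 0).2.2.1,
      fun y => fz (E 0 y).2.2.1, fun x y => fz (E x y).2.2.2, fun x y => fz (N x y).2.2.2, τ⟩ ∧
    ∀ x y, (E x y).1 = (E 0 y).1 := by
  have hW : ∀ x y, W x y = E (x - 1) y := fun x y => by rw [hE, sub_add_cancel]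
  have hS : ∀ x y, S x y = N x (y - 1) := fun x y => by rw [hN, sub_add_cancel]
  have c1 : ∀ x y, (E x y).1 = (E 0 y).1 := fun x y =>
    const_int (u := fun x => (E x y).1) (fun x => by
      have := (hOK (x + 1) y).1.1
      rw [← hE] at this
      exact this) x
  have c2 : ∀ x y, (E x y).2.2.1 = (E 0 y).2.2.1 := fun x y =>
    const_int (u := fun x => (E x y).2.2.1) (fun x => by
      have := (hOK (x + 1) y).1.2.1
      rw [← hE] at this
      exact this) x
  have c3 : ∀ x y, (N x y).1 = (N x 0).1 := fun x y =>
    const_int (u := fun y => (N x y).1) (fun y => by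
      have := (hOK x (y + 1)).1.2.2.1
      rw [← hN] at this
      exact this) y
  have c4 : ∀ x y, (N x y).2.2.1 = (N x 0).2.2.1 := fun x y =>
    const_int (u := fun y => (N x y).2.2.1) (fun y => by
      have := (hOK x (y + 1)).1.2.2.2.1
      rw [← hN] at this
      exact this) y
  have c5 : ∀ x y, (E x y).2.1 = (N x 0).1 := fun x y => by rw [(hOK x y).1.2.2.2.2.1, c3]
  have c6 : ∀ x y, (N x y).2.1 = (E 0 y).1 := fun x y => by rw [(hOK x y).1.2.2.2.2.2, c1]
  refine ⟨⟨?_, ?_, ?_, ?_⟩, c1⟩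
  · intro x
    have := (hOK (x + 1) 0).2.1
    rw [← hE, c5, c5] at this
    exact this
  · intro y
    have := (hOK 0 (y + 1)).2.2.1
    rw [← hN, c6, c6] at this
    exact this
  · intro x y
    have := (hOK x y).2.2.2.1
    rw [hW, c5, c1, c4] at this
    exact this
  · intro x y
    have := (hOK x y).2.2.2.2
    rw [hS, c5, c1, c2] at this
    exact this

theorem crt (i j : ℕ) (a b : ℤ) : ∃ x : ℤ, (2:ℤ) ^ (i + 1) ∣ x - a ∧ (3:ℤ) ^ (j + 1) ∣ x - b := by
  have h : IsCoprime ((2:ℤ) ^ (i + 1)) ((3:ℤ) ^ (j + 1)) := by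
    apply IsCoprime.pow
    rw [Int.isCoprime_iff_gcd_eq_one]
    rfl
  obtain ⟨u, v, huv⟩ := h
  refine ⟨a + u * 2 ^ (i + 1) * (b - a), ⟨u * (b - a), by ring⟩, ⟨v * (a - b), ?_⟩⟩
  linear_combination (b - a) * huv

theorem sol_of_tiling {G : List ((ℕ × ℕ × ℕ × ℕ) × Kap)} {lab : List Lb} {R : Kap → Lb → Lb → Bool}
    (hG : ∀ z, z ∈ G ↔ ∃ k : HT, k.OK ∧ k.out = z)
    (hR : ∀ zi zj r c, R (some (1, 1, zi, zj)) r c = true → r = c)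
    {f : ℤ × ℤ → WangTile} (hf : IsWangTilingL (tiles G lab R) f) : Sol lab R := by
  have H : ∀ x y : ℤ, ∃ (k : HT) (r c : Lb), k.OK ∧ r ∈ lab ∧ c ∈ lab ∧ R k.kap r c = true ∧
      f (x, y) = mk k.out r c := by
    intro x y
    obtain ⟨z, hz, r, hr, c, hc, h1, h2⟩ := mem_tiles.1 (hf.1 (x, y))
    obtain ⟨k, hk, rfl⟩ := (hG z).1 hz
    exact ⟨k, r, c, hk, hr, hc, h1, h2⟩
  choose K r c hK hr hc hRR hfK using H
  have hE : ∀ x y, (K x y).E = (K (x + 1) y).W ∧ r x y = r (x + 1) y := by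
    intro x y
    have := (hf.2 x y).1
    rw [hfK, hfK] at this
    simp only [WangTile.east, WangTile.west, mk, HT.out, Nat.pair_eq_pair] at this
    exact ⟨Encodable.encode_injective this.1, Encodable.encode_injective this.2⟩
  have hN : ∀ x y, (K x y).N = (K x (y + 1)).S ∧ c x y = c x (y + 1) := by
    intro x y
    have := (hf.2 x y).2
    rw [hfK, hfK] at this
    simp only [WangTile.north, WangTile.south, mk, HT.out, Nat.pair_eq_pair] at this
    exact ⟨Encodable.encode_injective this.1, Encodable.encode_injective this.2⟩
  have rr : ∀ x y, r x y = r 0 y := fun x y =>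
    const_int (u := fun x => r x y) (fun x => (hE x y).2.symm) x
  have cc : ∀ x y, c x y = c x 0 := fun x y =>
    const_int (u := fun y => c x y) (fun y => (hN x y).2.symm) y
  have V2 := extract (fun x y => (hK x y).1) (fun x y => congrArg Prod.fst (hE x y).1)
    (fun x y => congrArg Prod.fst (hN x y).1)
  have V3 := extract (fun x y => (hK x y).2) (fun x y => congrArg Prod.snd (hE x y).1)
    (fun x y => congrArg Prod.snd (hN x y).1)
  obtain ⟨a2, b2, F2⟩ := force (.inl ⟨rfl, rfl, rfl⟩) V2.1
  obtain ⟨a3, b3, F3⟩ := force (.inr ⟨rfl, rfl, rfl⟩) V3.1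
  have HX := fun i j => crt i j (a2 i) (a3 j)
  have HY := fun i j => crt i j (b2 i) (b3 j)
  choose X hX2 hX3 using HX
  choose Y hY2 hY3 using HY
  have key : ∀ (i j i' j' : ℕ) (a b : Fin 3), i' + 1 = i + a.val → j' + 1 = j + b.val →
      R (some (a, b, decide (i = 0), decide (j = 0))) (r 0 (Y i j)) (c (X i' j') 0) = true := by
    intro i j i' j' a b ha hb
    have h := hRR (X i' j') (Y i j)
    have f2 := F2 i' i _ _ (hX2 i' j') (hY2 i j)
    have f3 := F3 j' j _ _ (hX3 i' j') (hY3 i j)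
    rw [rr, cc] at h
    simp only [HT.kap] at h
    rw [V2.2, V3.2] at h
    simp only at f2 f3
    have e2 : ft (K (X i' j') (Y i j)).t2 + 1 = (a.val : ℤ) := by
      have := a.isLt
      obtain h | h | h : a.val = 0 ∨ a.val = 1 ∨ a.val = 2 := by omega
      · have := f2.2.2.2.2 (by omega); omega
      · have := f2.2.2.1 (by omega); omega
      · have := f2.2.2.2.1 (by omega); omega
    have e3 : ft (K (X i' j') (Y i j)).t3 + 1 = (b.val : ℤ) := by
      have := b.isLt
      obtain h | h | h : b.val = 0 ∨ b.val = 1 ∨ b.val = 2 := by omega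
      · have := f3.2.2.2.2 (by omega); omega
      · have := f3.2.2.1 (by omega); omega
      · have := f3.2.2.2.1 (by omega); omega
    have ek : ∀ zi zj, kap (ft (K (X i' j') (Y i j)).t2) (ft (K (X i' j') (Y i j)).t3) zi zj =
        some (a, b, zi, zj) := by
      intro zi zj
      have := a.isLt
      have := b.isLt
      rw [kap, if_pos (by omega), z3_eq e2, z3_eq e3]
    rw [ek] at h
    have g2 : decide (i = 0) = decide (¬ (2:ℤ) ∣ fz (K 0 (Y i j)).E.1.1) :=
      decide_eq_decide.2 (by rw [f2.2.1, not_not])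
    have g3 : decide (j = 0) = decide (¬ (3:ℤ) ∣ fz (K 0 (Y i j)).E.2.1) :=
      decide_eq_decide.2 (by rw [f3.2.1, not_not])
    rw [g2, g3]
    exact h
  have diag : ∀ i j, r 0 (Y i j) = c (X i j) 0 := fun i j =>
    hR _ _ _ _ (key i j i j 1 1 rfl rfl)
  refine ⟨fun i j => c (X i j) 0, fun i j => hc _ _, ?_⟩
  intro i j i' j' a b ha hb
  simp only [← diag i j]
  exact key i j i' j' a b ha hb

def hw (C : Cfg) (x y : ℤ) : Q := (zf (C.g y), zf (C.f x), zf (C.E y), zf (C.h x y))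
def vn (C : Cfg) (x y : ℤ) : Q := (zf (C.f x), zf (C.g y), zf (C.D x), zf (C.v x y))

theorem HalfOK.bd {p p2 p3 f g d q q' t : ℤ} (h : HalfOK p p2 p3 f g d q q' t) :
    -2 ≤ t ∧ t ≤ 2 := by
  unfold HalfOK EvOK at h
  constructor
  · rcases h with ⟨-, -, h | h | h | h⟩ | ⟨-, h | ⟨-, h | h | h | h⟩⟩ <;> omega
  · rcases h with ⟨-, -, h | h | h | h⟩ | ⟨-, h | ⟨-, h | h | h | h⟩⟩ <;> omega

theorem LT_of_valid {p p2 p3 : ℤ} (hp : PD p p2 p3) {C : Cfg} (hC : Valid p p2 p3 C)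
    (hB : Bounded p2 p3 C) (x y : ℤ) :
    LT p p2 p3 (hw C (x - 1) y) (vn C x (y - 1)) (hw C x y) (vn C x y) (ft (tf (C.τ x y))) ∧
      ft (tf (C.τ x y)) = C.τ x y ∧ fz (hw C x y).1 = C.g y := by
  have h2 : p2 ≤ 27 ∧ p3 ≤ 27 := by
    rcases hp with ⟨rfl, rfl, rfl⟩ | ⟨rfl, rfl, rfl⟩ <;> omega
  have ff : ∀ x, fz (zf (C.f x)) = C.f x := fun x => fz_zf (hB.f x).1 ((hB.f x).2.trans_le h2.1)
  have fg : ∀ x, fz (zf (C.g x)) = C.g x := fun x => fz_zf (hB.g x).1 ((hB.g x).2.trans_le h2.1)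
  have fD : ∀ x, fz (zf (C.D x)) = C.D x := fun x => fz_zf (hB.D x).1 ((hB.D x).2.trans_le h2.1)
  have fE : ∀ x, fz (zf (C.E x)) = C.E x := fun x => fz_zf (hB.E x).1 ((hB.E x).2.trans_le h2.1)
  have fh : ∀ x y, fz (zf (C.h x y)) = C.h x y := fun x y =>
    fz_zf (hB.h x y).1 ((hB.h x y).2.trans_le h2.2)
  have fv : ∀ x y, fz (zf (C.v x y)) = C.v x y := fun x y =>
    fz_zf (hB.v x y).1 ((hB.v x y).2.trans_le h2.2)
  have ht := (hC.ho x y).bd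
  have e := ft_tf ht.1 ht.2
  refine ⟨?_, e, fg y⟩
  rw [e]
  unfold LT hw vn
  simp only [ff, fg, fD, fE, fh, fv]
  refine ⟨by simp, ?_, ?_, hC.ho x y, hC.ve x y⟩
  · have := hC.fs (x - 1)
    rwa [sub_add_cancel] at this
  · have := hC.gs (y - 1)
    rwa [sub_add_cancel] at this

theorem tiling_of_sol {G : List ((ℕ × ℕ × ℕ × ℕ) × Kap)} {lab : List Lb} {R : Kap → Lb → Lb → Bool}
    (hG : ∀ z, z ∈ G ↔ ∃ k : HT, k.OK ∧ k.out = z)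
    (hR : ∀ r, R (some (1, 1, false, false)) r r = true)
    (hRn : ∀ r c, R none r c = true) (hs : Sol lab R) :
    ∃ f : ℤ × ℤ → WangTile, IsWangTilingL (tiles G lab R) f := by
  obtain ⟨t, htl, ht⟩ := hs
  have hp2 : PD 2 4 8 := .inl ⟨rfl, rfl, rfl⟩
  have hp3 : PD 3 9 27 := .inr ⟨rfl, rfl, rfl⟩
  obtain ⟨C2, V2, B2, z2, z20, T2, T2a, T2b, T2c⟩ := exists_cfg hp2
  obtain ⟨C3, V3, B3, z3', z30, T3, T3a, T3b, T3c⟩ := exists_cfg hp3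
  let K : ℤ → ℤ → HT := fun x y =>
    ⟨(hw C2 (x - 1) y, hw C3 (x - 1) y), (vn C2 x (y - 1), vn C3 x (y - 1)),
      (hw C2 x y, hw C3 x y), (vn C2 x y, vn C3 x y), tf (C2.τ x y), tf (C3.τ x y)⟩
  let sym : ℤ → Lb := fun x => if x = 0 then t 0 0 else t (lev 2 x) (lev 3 x)
  refine ⟨fun w => mk (K w.1 w.2).out (sym w.2) (sym w.1), ?_, ?_⟩
  · rintro ⟨x, y⟩
    have L2 := LT_of_valid hp2 V2 B2 x y
    have L3 := LT_of_valid hp3 V3 B3 x y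
    have hl : ∀ x, sym x ∈ lab := by
      intro x
      simp only [sym]
      split_ifs <;> exact htl _ _
    refine mem_tiles.2 ⟨_, (hG _).2 ⟨K x y, ⟨L2.1, L3.1⟩, rfl⟩, _, hl _, _, hl _, ?_, rfl⟩
    simp only [HT.out, HT.kap, K, L2.2.1, L3.2.1, L2.2.2, L3.2.2]
    unfold kap
    split_ifs with hc
    · by_cases hx : x = 0
      · subst hx
        by_cases hy : y = 0
        · subst hy
          have := hR (sym 0)
          simpa [T2c, T3c, z20, z30, show z3 0 = 1 from rfl] using this
        · have := T2b y hy
          omega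
      · by_cases hy : y = 0
        · subst hy
          have := T2a x hx
          omega
        · simp only [sym, hx, hy, if_false]
          have e2 := T2 x y hx hy hc.1 hc.2.1
          have e3 := T3 x y hx hy hc.2.2.1 hc.2.2.2
          have := ht (lev 2 y) (lev 3 y) (lev 2 x) (lev 3 x) (z3 (C2.τ x y)) (z3 (C3.τ x y))
            (by simp only [z3]; omega) (by simp only [z3]; omega)
          have g2 : decide (¬ (2:ℤ) ∣ C2.g y) = decide (lev 2 y = 0) :=
            decide_eq_decide.2 (by rw [z2 y hy, not_not])
          have g3 : decide (¬ (3:ℤ) ∣ C3.g y) = decide (lev 3 y = 0) :=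
            decide_eq_decide.2 (by rw [z3' y hy, not_not])
          rw [g2, g3]
          exact this
    · exact hRn _ _
  · intro x y
    simp [K, mk, HT.out, WangTile.east, WangTile.west, WangTile.north, WangTile.south]

end
end Domino

namespace Domino

/-! quarter-plane computations -/
section Machine
open Turing

structure St (Γ Λ : Type) where
  q : Λ
  h : Γ
  R : Γ
  L : Γ


theorem exists_dec {Γ Λ : Type} [Finite Γ] {S : Set Λ} (hS : S.Finite) : ∃ (N : ℕ) (dec : Fin N → St Γ Λ),
    Set.range dec = {s | s.q ∈ S} := by
  have := hS.to_subtype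
  obtain ⟨N, ⟨e⟩⟩ := Finite.exists_equiv_fin (S × Γ × Γ × Γ)
  refine ⟨N, fun k => ⟨(e.symm k).1, (e.symm k).2.1, (e.symm k).2.2.1, (e.symm k).2.2.2⟩, ?_⟩
  ext ⟨q, h, R, L⟩
  constructor
  · rintro ⟨k, hk⟩
    simp only [St.mk.injEq] at hk
    exact hk.1 ▸ (e.symm k).1.2
  · intro hq
    exact ⟨e (⟨q, hq⟩, h, R, L), by simp⟩

variable {Γ Λ : Type} [Inhabited Γ] [Inhabited Λ]

def inp (s0 s1 b : Γ) : Fin 4 → Γ := ![s0, s1, b, default]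

def Act (zi : Bool) (a : Fin 3) (s s' : St Γ Λ) : TM0.Stmt Γ → Prop
  | .write β => a = 1 →
      (zi = true → s'.R = β ∧ s'.L = β) ∧ (zi = false → s'.R = s.R ∧ s'.L = s.L)
  | .move .right => (a = 0 → s'.R = s.R) ∧ (a = 2 → s'.L = s.L)
  | .move .left => (a = 2 → s'.R = s.R) ∧ (a = 0 → s'.L = s.L)

def Con (M : TM0.Machine Γ Λ) (s0 s1 b : Γ) (a c : Fin 3) (zi zj : Bool) (s s' : St Γ Λ)
    (same : Prop) (k : Fin 4) (st : Prop) : Prop :=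
  (a = 1 → c = 1 → same ∧ (zi = true → s.R = s.h ∧ s.L = s.h) ∧
    (zj = true → s.q = default ∧ s.R = inp s0 s1 b k ∧ (k ≠ 0 → s.L = default)) ∧
    (zi = true → zj = true → k = 0)) ∧
  (a = 2 → c = 1 → s'.q = s.q ∧ s'.h = s.h ∧ (zj = true → st)) ∧
  (c = 2 → ∃ stmt, M s.q s.h = some (s'.q, stmt) ∧ Act zi a s s' stmt)

def cls (n c : ℕ) : Fin 4 := if c = 0 then 0 else if c = 1 then 1 else if c < n + 2 then 2 else 3

theorem inp_cls (s0 s1 b : Γ) (n i : ℕ) :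
    inp s0 s1 b (cls n (min i (n + 2))) = (s0 :: s1 :: List.replicate n b).getI i := by
  rcases i with _ | _ | i
  · simp [cls, inp]
  · have : min 1 (n + 2) = 1 := by omega
    simp [cls, inp, this]
  · simp only [List.getI_cons_succ]
    by_cases h : i < n
    · have : min (i + 1 + 1) (n + 2) = i + 2 := by omega
      rw [List.getI_eq_getElem _ (by simpa using h)]
      simp [cls, inp, this, h]
    · have : min (i + 1 + 1) (n + 2) = n + 2 := by omega
      rw [List.getI_eq_default _ (by simpa using h)]
      simp [cls, inp, this]

def Stp (n c c' : ℕ) : Prop := c' = c + 1 ∨ (c = n + 2 ∧ c' = n + 2)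

instance (n c c' : ℕ) : Decidable (Stp n c c') := by unfold Stp; infer_instance

def QSol (M : TM0.Machine Γ Λ) (s0 s1 b : Γ) (S : Set Λ) (n : ℕ) : Prop :=
  ∃ (t : ℕ → ℕ → St Γ Λ) (cn : ℕ → ℕ → ℕ), (∀ i j, (t i j).q ∈ S) ∧ (∀ i j, cn i j < n + 3) ∧
  ∀ (i j i' j' : ℕ) (a c : Fin 3), i' + 1 = i + a.val → j' + 1 = j + c.val →
    Con M s0 s1 b a c (decide (i = 0)) (decide (j = 0)) (t i j) (t i' j')
      (a = 1 → c = 1 → True) (cls n (cn i j)) (Stp n (cn i j) (cn i' j'))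

theorem mk1_nth_nat (l : List Γ) (i : ℕ) : (Tape.mk₁ l).nth i = l.getI i := by
  unfold Tape.mk₁ Tape.mk₂
  rw [Tape.mk'_nth_nat, ListBlank.nth_mk]

theorem mk1_nth_neg (l : List Γ) (i : ℕ) (hi : i ≠ 0) : (Tape.mk₁ l).nth (-(i : ℤ)) = default := by
  obtain ⟨k, rfl⟩ := Nat.exists_eq_succ_of_ne_zero hi
  have : (-((k.succ : ℕ) : ℤ)) = Int.negSucc k := by simp [Int.negSucc_eq]
  rw [this]
  show (ListBlank.mk []).nth k = default
  rw [ListBlank.nth_mk, List.getI_nil]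

/-- the symbol at `i` after acting -/
def act (T : Tape Γ) : TM0.Stmt Γ → Tape Γ
  | .move d => T.move d
  | .write a => T.write a

theorem mem_step {M : TM0.Machine Γ Λ} {c c' : TM0.Cfg Γ Λ} : c' ∈ TM0.step M c ↔
    ∃ stmt, M c.q (c.Tape.nth 0) = some (c'.q, stmt) ∧ c'.Tape = act c.Tape stmt := by
  obtain ⟨q, T⟩ := c
  obtain ⟨q', T'⟩ := c'
  simp only [TM0.step, Tape.nth_zero, Option.mem_def, Option.map_eq_some_iff, TM0.Cfg.mk.injEq]
  constructor
  · rintro ⟨⟨q1, s⟩, h1, h2, h3⟩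
    simp only at h2 h3
    subst h2
    refine ⟨s, h1, ?_⟩
    rw [← h3]
    cases s <;> rfl
  · rintro ⟨s, h1, h2⟩
    refine ⟨(q', s), h1, rfl, ?_⟩
    rw [h2]
    cases s <;> rfl

def Mt (t : ℕ → ℕ → St Γ Λ) (j : ℕ) (c : TM0.Cfg Γ Λ) : Prop :=
  ∀ i, t i j = ⟨c.q, c.Tape.nth 0, c.Tape.nth i, c.Tape.nth (-(i : ℤ))⟩

theorem not_halt_of_qsol {M : TM0.Machine Γ Λ} {s0 s1 b : Γ} {S : Set Λ} {n : ℕ}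
    (hq : QSol M s0 s1 b S n) : ¬ (StateTransition.eval (TM0.step M)
      (TM0.init (s0 :: s1 :: List.replicate n b))).Dom := by
  obtain ⟨t, cn, -, hcn, H⟩ := hq
  have U := fun i j => (H i j i j 1 1 rfl rfl).1 rfl rfl
  have Hh := fun i j => (H i j (i + 1) j 2 1 rfl rfl).2.1 rfl rfl
  have V := fun i j i' (a : Fin 3) (h : i' + 1 = i + a.val) =>
    (H i j i' (j + 1) a 2 h rfl).2.2 rfl
  have hqc : ∀ i j, (t i j).q = (t 0 j).q ∧ (t i j).h = (t 0 j).h := by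
    intro i j
    induction i with
    | zero => exact ⟨rfl, rfl⟩
    | succ i ih => exact ⟨(Hh i j).1.trans ih.1, (Hh i j).2.1.trans ih.2⟩
  have hc : ∀ i, cn i 0 = min i (n + 2) := by
    intro i
    induction i with
    | zero =>
      have := (U 0 0).2.2.2 (by simp) (by simp)
      simp only [cls] at this
      split_ifs at this with h1 <;> simp_all
    | succ i ih =>
      have := (Hh i 0).2.2 (by simp)
      have h2 := hcn (i + 1) 0
      unfold Stp at this
      omega
  have h0 : ∀ j, (t 0 j).R = (t 0 j).h ∧ (t 0 j).L = (t 0 j).h := fun j =>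
    (U 0 j).2.1 (by simp)
  have M0 : Mt t 0 (TM0.init (s0 :: s1 :: List.replicate n b)) := by
    have hR : ∀ i : ℕ, (t i 0).R = (Tape.mk₁ (s0 :: s1 :: List.replicate n b)).nth i := by
      intro i
      have := ((U i 0).2.2.1 (by simp)).2.1
      rw [this, hc, inp_cls, mk1_nth_nat]
    have hh : (t 0 0).h = (Tape.mk₁ (s0 :: s1 :: List.replicate n b)).nth 0 := by
      rw [← (h0 0).1, hR]; rfl
    intro i
    have h1 := hqc i 0
    have h2 := hR i
    have h3 : (t i 0).q = default := ((U i 0).2.2.1 (by simp)).1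
    have h4 : (t i 0).L = (Tape.mk₁ (s0 :: s1 :: List.replicate n b)).nth (-(i:ℤ)) := by
      rcases eq_or_ne i 0 with rfl | hi
      · rw [(h0 0).2, hh]; rfl
      · rw [mk1_nth_neg _ _ hi]
        refine ((U i 0).2.2.1 (by simp)).2.2 ?_
        rw [hc]
        unfold cls
        rw [if_neg (by omega)]
        split_ifs <;> simp
    have h5 := h1.2.trans hh
    rcases ht : t i 0 with ⟨q, h, R, L⟩
    rw [ht] at h2 h3 h4 h5
    simp only at h2 h3 h4 h5
    simp only [h2, h3, h4, h5, TM0.init]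
  have Ms : ∀ j c, Mt t j c → ∃ stmt, M c.q (c.Tape.nth 0) = some ((t 0 (j + 1)).q, stmt) := by
    intro j c hm
    obtain ⟨stmt, h1, -⟩ := V 0 j 0 1 rfl
    have := hm 0
    rw [this] at h1
    exact ⟨stmt, h1⟩
  have Mn : ∀ j c c', Mt t j c → c' ∈ TM0.step M c → Mt t (j + 1) c' := by
    intro j c c' hm hs
    obtain ⟨stmt, h1, h2⟩ := mem_step.1 hs
    have W : ∀ i i' (a : Fin 3), i' + 1 = i + a.val → (t i' (j + 1)).q = c'.q ∧
        Act (decide (i = 0)) a (t i j) (t i' (j + 1)) stmt := by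
      intro i i' a hi
      obtain ⟨stmt', h3, h4⟩ := V i j i' a hi
      have := hm i
      rw [this] at h3
      simp only [h1, Option.some.injEq, Prod.mk.injEq] at h3
      obtain ⟨h5, rfl⟩ := h3
      exact ⟨h5.symm, h4⟩
    have key : ∀ i : ℕ, (t i (j + 1)).R = c'.Tape.nth i ∧
        (i ≠ 0 → (t i (j + 1)).L = c'.Tape.nth (-(i:ℤ))) := by
      intro i
      rw [h2]
      rcases stmt with (_ | _) | β
      · constructor
        · rcases i with _ | i
          · have := (W 1 0 0 rfl).2.2 rfl
            rw [(h0 (j + 1)).1, ← (h0 (j + 1)).2, this, hm]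
            simp only [act, Tape.move_left_nth]
            congr 1
          · have := (W i (i + 1) 2 rfl).2.1 rfl
            rw [this, hm]
            simp [act, Tape.move_left_nth]
        · intro _
          have := (W (i + 1) i 0 rfl).2.2 rfl
          rw [this, hm]
          simp only [act, Tape.move_left_nth]
          congr 1
          push_cast
          ring
      · constructor
        · have := (W (i + 1) i 0 rfl).2.1 rfl
          rw [this, hm]
          simp [act, Tape.move_right_nth]
        · intro hi
          obtain ⟨k, rfl⟩ := Nat.exists_eq_succ_of_ne_zero hi
          have := (W k (k + 1) 2 rfl).2.2 rfl
          rw [Nat.succ_eq_add_one, this, hm]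
          simp only [act, Tape.move_right_nth]
          congr 1
          push_cast
          ring
      · have := (W i i 1 rfl).2 rfl
        rcases eq_or_ne i 0 with rfl | hi
        · have := this.1 (by simp)
          simp only [this.1, act, Tape.write_nth]
          simp
        · have := this.2 (by simp [hi])
          rw [this.1, this.2, hm]
          simp [act, Tape.write_nth, hi]
    intro i
    have h3 := (W i i 1 rfl).1
    have h4 := hqc i (j + 1)
    have h5 := key i
    have h6 := key 0
    have h7 : (t i (j + 1)).h = c'.Tape.nth 0 := by
      rw [h4.2, ← (h0 (j + 1)).1, h6.1]; rfl
    have h8 : (t i (j + 1)).L = c'.Tape.nth (-(i:ℤ)) := by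
      rcases eq_or_ne i 0 with rfl | hi
      · rw [(h0 (j + 1)).2, h7]; rfl
      · exact h5.2 hi
    have h9 := h5.1
    rcases ht : t i (j + 1) with ⟨q, h, R, L⟩
    rw [ht] at h3 h7 h8 h9
    simp only at h3 h7 h8 h9
    simp only [h3, h7, h8, h9]
  have Mr : ∀ c, StateTransition.Reaches (TM0.step M)
      (TM0.init (s0 :: s1 :: List.replicate n b)) c → ∃ j, Mt t j c := by
    intro c hc
    induction hc with
    | refl => exact ⟨0, M0⟩
    | tail _ h2 ih =>
      obtain ⟨j, hj⟩ := ih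
      exact ⟨j + 1, Mn j _ _ hj h2⟩
  intro hd
  obtain ⟨c, hc⟩ := Part.dom_iff_mem.1 hd
  obtain ⟨h1, h2⟩ := StateTransition.mem_eval.1 hc
  obtain ⟨j, hj⟩ := Mr c h1
  obtain ⟨stmt, hs⟩ := Ms j c hj
  have : (⟨(t 0 (j + 1)).q, act c.Tape stmt⟩ : TM0.Cfg Γ Λ) ∈ TM0.step M c :=
    mem_step.2 ⟨stmt, hs, rfl⟩
  rw [h2] at this
  simp at this

theorem qsol_of_not_halt {M : TM0.Machine Γ Λ} {s0 s1 b : Γ} {S : Set Λ} {n : ℕ}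
    (hS : TM0.Supports M S) (hn : ¬ (StateTransition.eval (TM0.step M)
      (TM0.init (s0 :: s1 :: List.replicate n b))).Dom) : QSol M s0 s1 b S n := by
  let C : ℕ → TM0.Cfg Γ Λ := fun j => Nat.rec (TM0.init (s0 :: s1 :: List.replicate n b))
    (fun _ c => (TM0.step M c).getD c) j
  have step : ∀ j, StateTransition.Reaches (TM0.step M) (C 0) (C j) →
      C (j + 1) ∈ TM0.step M (C j) := by
    intro j h
    rcases hs : TM0.step M (C j) with _ | c
    · exact absurd (Part.dom_iff_mem.2 ⟨C j, StateTransition.mem_eval.2 ⟨h, hs⟩⟩) hn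
    · have : C (j + 1) = (TM0.step M (C j)).getD (C j) := rfl
      rw [this, hs]
      rfl
  have hr : ∀ j, StateTransition.Reaches (TM0.step M) (C 0) (C j) ∧
      C (j + 1) ∈ TM0.step M (C j) := by
    intro j
    suffices h : StateTransition.Reaches (TM0.step M) (C 0) (C j) from ⟨h, step j h⟩
    induction j with
    | zero => exact Relation.ReflTransGen.refl
    | succ j ih => exact Relation.ReflTransGen.tail ih (step j ih)
  have hq : ∀ j, (C j).q ∈ S := by
    intro j
    induction j with
    | zero => exact hS.1
    | succ j ih => exact TM0.step_supports M hS (hr j).2 ih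
  refine ⟨fun i j => ⟨(C j).q, (C j).Tape.nth 0, (C j).Tape.nth i, (C j).Tape.nth (-(i:ℤ))⟩,
    fun i _ => min i (n + 2), fun i j => hq j, fun i j => by dsimp only; omega, ?_⟩
  intro i j i' j' a c ha hc
  refine ⟨?_, ?_, ?_⟩
  · rintro rfl rfl
    refine ⟨fun _ _ => trivial, ?_, ?_, ?_⟩
    · intro h
      obtain rfl : i = 0 := by simpa using h
      simp
    · intro h
      obtain rfl : j = 0 := by simpa using h
      refine ⟨rfl, ?_, ?_⟩
      · rw [inp_cls]
        exact mk1_nth_nat _ _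
      · intro hk
        refine mk1_nth_neg _ _ ?_
        rintro rfl
        simp [cls] at hk
    · intro h _
      obtain rfl : i = 0 := by simpa using h
      simp [cls]
  · rintro rfl rfl
    obtain rfl : j' = j := by simpa using hc
    refine ⟨rfl, rfl, fun _ => ?_⟩
    obtain rfl : i' = i + 1 := by simpa using ha
    simp only [Stp]
    omega
  · rintro rfl
    obtain rfl : j' = j + 1 := by simpa using hc
    obtain ⟨stmt, h1, h2⟩ := mem_step.1 (hr j).2
    refine ⟨stmt, h1, ?_⟩
    simp only [h2]
    rcases stmt with (_ | _) | β
    · constructor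
      · rintro rfl
        obtain rfl : i' = i + 1 := by simpa using ha
        simp [act, Tape.move_left_nth]
      · rintro rfl
        obtain rfl : i = i' + 1 := by simpa using ha.symm
        simp only [act, Tape.move_left_nth]
        congr 1
        push_cast
        ring
    · constructor
      · rintro rfl
        obtain rfl : i = i' + 1 := by simpa using ha.symm
        simp [act, Tape.move_right_nth]
      · rintro rfl
        obtain rfl : i' = i + 1 := by simpa using ha
        simp only [act, Tape.move_right_nth]
        congr 1
        push_cast
        ring
    · rintro rfl
      obtain rfl : i' = i := by simpa using ha
      constructor
      · intro h
        obtain rfl : i' = 0 := by simpa using h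
        simp [act, Tape.write_nth, -Tape.nth_zero]
      · intro h
        have hi : i' ≠ 0 := by simpa using h
        simp [act, Tape.write_nth, hi]

end Machine
end Domino

namespace Domino

def labs (N n : ℕ) : List (ℕ × Fin N) :=
  (List.range (n + 3)).flatMap fun c => (List.finRange N).map fun k => (c, k)

theorem mem_labs {N n : ℕ} {l : ℕ × Fin N} : l ∈ labs N n ↔ l.1 < n + 3 := by
  obtain ⟨c, k⟩ := l
  simp [labs]

/-- finite part of the label relation -/
abbrev FinRel (N : ℕ) : Type := Kap × Fin N × Fin N × Fin 4 × Bool × Bool → Bool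

def rel {N : ℕ} (T : FinRel N) (n : ℕ) (κ : Kap) (l l' : ℕ × Fin N) : Bool :=
  T (κ, l.2, l'.2, cls n l.1, decide (l.1 = l'.1), decide (Stp n l.1 l'.1))

theorem primrec_cls : Primrec₂ cls := by
  have h1 : Primrec fun x : ℕ × ℕ => x.2 := Primrec.snd
  have h2 : Primrec fun x : ℕ × ℕ => x.1 + 2 :=
    Primrec.nat_add.comp Primrec.fst (Primrec.const 2)
  exact Primrec.ite (Primrec.eq.comp h1 (Primrec.const 0)) (Primrec.const 0)
    (Primrec.ite (Primrec.eq.comp h1 (Primrec.const 1)) (Primrec.const 1)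
      (Primrec.ite (Primrec.nat_lt.comp h1 h2) (Primrec.const 2) (Primrec.const 3)))

theorem primrec_stp : Primrec fun x : ℕ × ℕ × ℕ => decide (Stp x.1 x.2.1 x.2.2) := by
  have h1 : Primrec fun x : ℕ × ℕ × ℕ => x.2.1 := Primrec.fst.comp Primrec.snd
  have h3 : Primrec fun x : ℕ × ℕ × ℕ => x.2.2 := Primrec.snd.comp Primrec.snd
  have h2 : Primrec fun x : ℕ × ℕ × ℕ => x.1 + 2 :=
    Primrec.nat_add.comp Primrec.fst (Primrec.const 2)
  have h4 : Primrec fun x : ℕ × ℕ × ℕ => x.2.1 + 1 :=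
    Primrec.nat_add.comp h1 (Primrec.const 1)
  have : PrimrecPred fun x : ℕ × ℕ × ℕ => Stp x.1 x.2.1 x.2.2 :=
    (Primrec.eq.comp h3 h4).or ((Primrec.eq.comp h1 h2).and (Primrec.eq.comp h3 h2))
  exact this.decide

theorem primrec_labs (N : ℕ) : Primrec (labs N) := by
  unfold labs
  refine Primrec.list_flatMap (Primrec.list_range.comp
    (Primrec.nat_add.comp Primrec.id (Primrec.const 3))) ?_
  refine Primrec.list_map (Primrec.const _) ?_
  exact Primrec.pair (Primrec.snd.comp Primrec.fst) Primrec.snd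

theorem primrec_rel {N : ℕ} (T : FinRel N) :
    Primrec fun x : ℕ × Kap × (ℕ × Fin N) × (ℕ × Fin N) => rel T x.1 x.2.1 x.2.2.1 x.2.2.2 := by
  have k : Primrec fun x : ℕ × Kap × (ℕ × Fin N) × (ℕ × Fin N) => x.2.1 :=
    Primrec.fst.comp Primrec.snd
  have l : Primrec fun x : ℕ × Kap × (ℕ × Fin N) × (ℕ × Fin N) => x.2.2.1 :=
    Primrec.fst.comp (Primrec.snd.comp Primrec.snd)
  have l' : Primrec fun x : ℕ × Kap × (ℕ × Fin N) × (ℕ × Fin N) => x.2.2.2 :=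
    Primrec.snd.comp (Primrec.snd.comp Primrec.snd)
  have n : Primrec fun x : ℕ × Kap × (ℕ × Fin N) × (ℕ × Fin N) => x.1 := Primrec.fst
  have heq : PrimrecPred fun x : ℕ × Kap × (ℕ × Fin N) × (ℕ × Fin N) => x.2.2.1.1 = x.2.2.2.1 :=
    Primrec.eq.comp (Primrec.fst.comp l) (Primrec.fst.comp l')
  refine (Primrec.dom_finite T).comp ?_
  refine Primrec.pair k (Primrec.pair (Primrec.snd.comp l) (Primrec.pair (Primrec.snd.comp l')
    (Primrec.pair (primrec_cls.comp n (Primrec.fst.comp l)) (Primrec.pair heq.decide ?_))))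
  exact primrec_stp.comp (Primrec.pair n (Primrec.pair (Primrec.fst.comp l) (Primrec.fst.comp l')))

theorem primrec_mk (N : ℕ) : Primrec fun x : ((ℕ × ℕ × ℕ × ℕ) × Kap) × (ℕ × Fin N) × (ℕ × Fin N) =>
    mk x.1 x.2.1 x.2.2 := by
  have z : Primrec fun x : ((ℕ × ℕ × ℕ × ℕ) × Kap) × (ℕ × Fin N) × (ℕ × Fin N) => x.1.1 :=
    Primrec.fst.comp Primrec.fst
  have r : Primrec fun x : ((ℕ × ℕ × ℕ × ℕ) × Kap) × (ℕ × Fin N) × (ℕ × Fin N) =>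
      Encodable.encode x.2.1 := Primrec.encode.comp (Primrec.fst.comp Primrec.snd)
  have c : Primrec fun x : ((ℕ × ℕ × ℕ × ℕ) × Kap) × (ℕ × Fin N) × (ℕ × Fin N) =>
      Encodable.encode x.2.2 := Primrec.encode.comp (Primrec.snd.comp Primrec.snd)
  have z2 := Primrec.snd.comp z
  have z3 := Primrec.snd.comp z2
  exact Primrec.pair (Primrec₂.natPair.comp (Primrec.fst.comp z) r)
    (Primrec.pair (Primrec₂.natPair.comp (Primrec.fst.comp z2) c)
    (Primrec.pair (Primrec₂.natPair.comp (Primrec.fst.comp z3) r)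
      (Primrec₂.natPair.comp (Primrec.snd.comp z3) c)))

theorem primrec_tiles {N : ℕ} (G : List ((ℕ × ℕ × ℕ × ℕ) × Kap)) (T : FinRel N) :
    Primrec fun n => tiles G (labs N n) (rel T n) := by
  unfold tiles
  refine Primrec.list_flatMap (Primrec.const G) ?_
  refine Primrec.list_flatMap ((primrec_labs N).comp Primrec.fst) ?_
  refine Primrec.list_flatMap ((primrec_labs N).comp (Primrec.fst.comp Primrec.fst)) ?_
  have n : Primrec fun x : ((ℕ × ((ℕ × ℕ × ℕ × ℕ) × Kap)) × (ℕ × Fin N)) × (ℕ × Fin N) =>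
    x.1.1.1 := Primrec.fst.comp (Primrec.fst.comp Primrec.fst)
  have z : Primrec fun x : ((ℕ × ((ℕ × ℕ × ℕ × ℕ) × Kap)) × (ℕ × Fin N)) × (ℕ × Fin N) =>
    x.1.1.2 := Primrec.snd.comp (Primrec.fst.comp Primrec.fst)
  have r : Primrec fun x : ((ℕ × ((ℕ × ℕ × ℕ × ℕ) × Kap)) × (ℕ × Fin N)) × (ℕ × Fin N) =>
    x.1.2 := Primrec.snd.comp Primrec.fst
  have hr := (primrec_rel T).comp (Primrec.pair n (Primrec.pair (Primrec.snd.comp z)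
    (Primrec.pair r Primrec.snd)))
  have hm := (primrec_mk N).comp (Primrec.pair z (Primrec.pair r Primrec.snd))
  exact Primrec.ite (Primrec.eq.comp hr (Primrec.const true))
    (Primrec.list_cons.comp hm (Primrec.const [])) (Primrec.const [])

section
open Turing
variable {Γ Λ : Type} [Inhabited Γ] [Inhabited Λ]

open Classical in
noncomputable def TT (M : TM0.Machine Γ Λ) (s0 s1 b : Γ) {N : ℕ} (dec : Fin N → St Γ Λ) :
    FinRel N
  | (none, _) => true
  | (some (a, c, zi, zj), s, s', k, e, st) =>
      decide (Con M s0 s1 b a c zi zj (dec s) (dec s') (s = s' ∧ e = true) k (st = true))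

theorem Con.mono {M : TM0.Machine Γ Λ} {s0 s1 b : Γ} {a c : Fin 3} {zi zj : Bool} {s s' : St Γ Λ}
    {p p' : Prop} {k : Fin 4} {st : Prop} (h : Con M s0 s1 b a c zi zj s s' p k st)
    (hp : a = 1 → c = 1 → p → p') : Con M s0 s1 b a c zi zj s s' p' k st :=
  ⟨fun ha hc => ⟨hp ha hc (h.1 ha hc).1, (h.1 ha hc).2⟩, h.2⟩

theorem rel_iff {M : TM0.Machine Γ Λ} {s0 s1 b : Γ} {N : ℕ} {dec : Fin N → St Γ Λ} {n : ℕ}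
    {a c : Fin 3} {zi zj : Bool} {l l' : ℕ × Fin N} :
    rel (TT M s0 s1 b dec) n (some (a, c, zi, zj)) l l' = true ↔
      Con M s0 s1 b a c zi zj (dec l.2) (dec l'.2) (l.2 = l'.2 ∧ l.1 = l'.1) (cls n l.1)
        (Stp n l.1 l'.1) := by
  simp only [rel, TT, decide_eq_true_eq]

theorem sol_iff {M : TM0.Machine Γ Λ} {s0 s1 b : Γ} {N : ℕ} {dec : Fin N → St Γ Λ} {S : Set Λ}
    (hdec : Set.range dec = {s | s.q ∈ S}) {n : ℕ} :
    Sol (labs N n) (rel (TT M s0 s1 b dec) n) ↔ QSol M s0 s1 b S n := by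
  constructor
  · rintro ⟨t, h1, h2⟩
    refine ⟨fun i j => dec (t i j).2, fun i j => (t i j).1, ?_, fun i j => mem_labs.1 (h1 i j), ?_⟩
    · intro i j
      have : dec (t i j).2 ∈ Set.range dec := ⟨_, rfl⟩
      rw [hdec] at this
      exact this
    · intro i j i' j' a c ha hc
      exact (rel_iff.1 (h2 i j i' j' a c ha hc)).mono fun _ _ _ _ _ => trivial
  · rintro ⟨t, cn, h1, h2, h3⟩
    have : ∀ i j, ∃ k, dec k = t i j := by
      intro i j
      have : t i j ∈ Set.range dec := by rw [hdec]; exact h1 i j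
      exact this
    choose u hu using this
    refine ⟨fun i j => (cn i j, u i j), fun i j => mem_labs.2 (h2 i j), ?_⟩
    intro i j i' j' a c ha hc
    rw [rel_iff]
    simp only [hu]
    refine (h3 i j i' j' a c ha hc).mono ?_
    rintro rfl rfl -
    obtain rfl : i' = i := by simpa using ha
    obtain rfl : j' = j := by simpa using hc
    exact ⟨rfl, rfl⟩

theorem tiling_iff {M : TM0.Machine Γ Λ} {s0 s1 b : Γ} {N : ℕ} {dec : Fin N → St Γ Λ} {S : Set Λ}
    (hdec : Set.range dec = {s | s.q ∈ S}) (hS : TM0.Supports M S)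
    {G : List ((ℕ × ℕ × ℕ × ℕ) × Kap)} (hG : ∀ z, z ∈ G ↔ ∃ k : HT, k.OK ∧ k.out = z) {n : ℕ} :
    (∃ f, IsWangTilingL (tiles G (labs N n) (rel (TT M s0 s1 b dec) n)) f) ↔
      ¬ (StateTransition.eval (TM0.step M) (TM0.init (s0 :: s1 :: List.replicate n b))).Dom := by
  constructor
  · rintro ⟨f, hf⟩
    refine not_halt_of_qsol ((sol_iff hdec).1 (sol_of_tiling hG ?_ hf))
    intro zi zj r c h
    have := ((rel_iff.1 h).1 rfl rfl).1
    exact Prod.ext this.2 this.1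
  · intro h
    refine tiling_of_sol hG ?_ (fun _ _ => rfl) ((sol_iff hdec).2 (qsol_of_not_halt hS h))
    intro r
    rw [rel_iff]
    refine ⟨fun _ _ => ⟨⟨rfl, rfl⟩, ?_, ?_, ?_⟩, ?_, ?_⟩ <;> simp

end

theorem main : ¬ ∃ D : List WangTile → Bool, Computable D ∧
    ∀ l : List WangTile, D l = true ↔ ∃ f, IsWangTilingL l f := by
  rintro ⟨D, hD, hDt⟩
  obtain ⟨Γ, Λ, _, _, _, M, S, s0, s1, b, hSf, hS, hM⟩ := exists_tm
  obtain ⟨N, dec, hdec⟩ := exists_dec (Γ := Γ) hSf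
  obtain ⟨G, hG⟩ := exists_G
  refine ComputablePred.halting_problem 0 ?_
  have hc : Computable fun c : Nat.Partrec.Code => !(D (tiles G (labs N (Encodable.encode c))
      (rel (TT M s0 s1 b dec) (Encodable.encode c)))) :=
    (Primrec.not.to_comp).comp (hD.comp ((primrec_tiles G (TT M s0 s1 b dec)).to_comp.comp
      Computable.encode))
  refine ComputablePred.computable_iff.2 ⟨_, hc, ?_⟩
  funext c
  apply propext
  rw [← hM c]
  have h1 := hDt (tiles G (labs N (Encodable.encode c))
      (rel (TT M s0 s1 b dec) (Encodable.encode c)))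
  rw [tiling_iff hdec hS hG] at h1
  rcases hd : D (tiles G (labs N (Encodable.encode c))
      (rel (TT M s0 s1 b dec) (Encodable.encode c))) with _ | _
  · rw [hd] at h1
    simpa using h1
  · rw [hd] at h1
    simpa using h1

end Domino

/-- **Berger: undecidability of the Domino Problem.** There is no computable function from
Wang tile sets (encoded as finite lists of quadruples of naturals) to `Bool` deciding
whether the tile set admits a tiling of the plane. -/
theorem domino_problem_undecidable :
    ¬ ∃ D : List WangTile → Bool, Computable D ∧
        ∀ l : List WangTile, D l = true ↔ ∃ f, IsWangTilingL l f := by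
  exact Domino.main
end

section
/- Turing machines can be simulated by Wang tiles: there is a computable map assigning to every Turing machine M (in a fixed standard model, e.g., Mathlib's TM0 machines over a fixed finite alphabet, started on a blank tape) a Wang tile set S_M such that S_M admits a tiling of the plane if and only if M does not halt. -/
namespace Wang

structure Line (α : Type) where
  d : ZMod 4
  l : Bool
  b : Bool
  s : ZMod 4
  r : Bool
  dat : α

def Wrap {α β : Type} (a a' : Line α) (P : Line β) : Prop :=
  a' = {a with d := a.d + 1} ∧
    (a'.d = 0 ∨ (a'.d = 2 ∧ (a.l = true ↔ (P.d = 1 ∨ P.d = 3)) ∧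
      (P.b = true ↔ (a.r = true ∧ a.s = 0))))

def Act {α β : Type} (a a' : Line α) (P : Line β) : Prop :=
  a'.d = a.d + 1 ∧ a'.d = (if P.l = true then 3 else 1) ∧ a'.l = a.l ∧ a'.b = a.b ∧
    a'.s = a.s + (if P.b = true then 1 else 0) ∧ a'.r = P.b ∧
    (P.b = true → a'.s = 0 → P.l = false)

abbrev DatRule (α β : Type) := Bool → Bool → α → β → α → β → Prop

def TA {α β : Type} (W : Line α) (S : Line β) (E : Line α) (N : Line β) : Prop :=
  E = W ∧ Wrap S N W

def TB {α β : Type} (W : Line α) (S : Line β) (E : Line α) (N : Line β) : Prop :=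
  N = S ∧ Wrap W E S

def TC {α β : Type} (D : DatRule α β) (W : Line α) (S : Line β) (E : Line α) (N : Line β) : Prop :=
  Act W E S ∧ Act S N W ∧ D S.b W.b W.dat S.dat E.dat N.dat

def Tile {α β : Type} (D : DatRule α β) (W : Line α) (S : Line β) (E : Line α) (N : Line β) : Prop :=
  TA W S E N ∨ TB W S E N ∨ TC D W S E N

def DatRule.symm {α β : Type} (D : DatRule α β) : DatRule β α :=
  fun c r w s e n => D r c s w n e

structure Good {α β : Type} (k : ℕ) (D : DatRule α β) (h : ℤ → ℤ → Line α) (v : ℤ → ℤ → Line β) :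
    Prop where
  cc : ∀ x y, Odd x → Odd y → TC D (h x y) (v x y) (h (x+1) y) (v x (y+1))
  aa : ∀ x y, Odd x → Even y → TA (h x y) (v x y) (h (x+1) y) (v x (y+1))
  bb : ∀ x y, Even x → Odd y → TB (h x y) (v x y) (h (x+1) y) (v x (y+1))
  tile : ∀ x y, Tile D (h x y) (v x y) (h (x+1) y) (v x (y+1))
  colb : ∃ o, Odd o ∧ ∀ x y, Odd x → ((v x y).b = true ↔ (2^(k+1) : ℤ) ∣ x - o)
  rowb : ∃ o, Odd o ∧ ∀ x y, Odd y → ((h x y).b = true ↔ (2^(k+1) : ℤ) ∣ y - o)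

theorem TC.symm {α β : Type} {D : DatRule α β} {W : Line α} {S : Line β} {E : Line α} {N : Line β}
    (h : TC D W S E N) : TC D.symm S W N E := ⟨h.2.1, h.1, h.2.2⟩

theorem Tile.symm {α β : Type} {D : DatRule α β} {W : Line α} {S : Line β} {E : Line α} {N : Line β}
    (h : Tile D W S E N) : Tile D.symm S W N E := by
  rcases h with h | h | h
  · exact Or.inr (Or.inl h)
  · exact Or.inl h
  · exact Or.inr (Or.inr h.symm)

theorem Good.symm {α β : Type} {k : ℕ} {D : DatRule α β} {h : ℤ → ℤ → Line α} {v : ℤ → ℤ → Line β}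
    (g : Good k D h v) : Good k D.symm (fun x y => v y x) (fun x y => h y x) where
  cc x y hx hy := (g.cc y x hy hx).symm
  aa x y hx hy := g.bb y x hy hx
  bb x y hx hy := g.aa y x hy hx
  tile x y := (g.tile y x).symm
  colb := by
    obtain ⟨o, ho, h⟩ := g.rowb
    exact ⟨o, ho, fun x y hx => h y x hx⟩
  rowb := by
    obtain ⟨o, ho, h⟩ := g.colb
    exact ⟨o, ho, fun x y hx => h y x hx⟩

theorem Good.shift {α β : Type} {k : ℕ} {D : DatRule α β} {h : ℤ → ℤ → Line α} {v : ℤ → ℤ → Line β}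
    (g : Good k D h v) (p q : ℤ) (hp : Even p) (hq : Even q) :
    Good k D (fun x y => h (x + p) (y + q)) (fun x y => v (x + p) (y + q)) where
  cc x y hx hy := by
    have := g.cc (x + p) (y + q) (hx.add_even hp) (hy.add_even hq)
    simpa only [add_right_comm] using this
  aa x y hx hy := by
    have := g.aa (x + p) (y + q) (hx.add_even hp) (hy.add hq)
    simpa only [add_right_comm] using this
  bb x y hx hy := by
    have := g.bb (x + p) (y + q) (hx.add hp) (hy.add_even hq)
    simpa only [add_right_comm] using this
  tile x y := by
    have := g.tile (x + p) (y + q)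
    simpa only [add_right_comm] using this
  colb := by
    obtain ⟨o, ho, h⟩ := g.colb
    refine ⟨o - p, ho.sub_even hp, fun x y hx => ?_⟩
    rw [h _ _ (hx.add_even hp)]
    ring_nf
  rowb := by
    obtain ⟨o, ho, h⟩ := g.rowb
    refine ⟨o - q, ho.sub_even hq, fun x y hx => ?_⟩
    rw [h _ _ (hx.add_even hq)]
    ring_nf

section
variable {α β : Type} {k : ℕ} {D : DatRule α β} {h : ℤ → ℤ → Line α} {v : ℤ → ℤ → Line β}

theorem const_of_step {γ : Type} (f : ℤ → γ) (hf : ∀ x, f (x + 1) = f x) (x y : ℤ) : f x = f y := by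
  have key : ∀ x, f x = f 0 := by
    intro x
    induction x using Int.induction_on with
    | zero => rfl
    | succ i ih => rw [hf, ih]
    | pred i ih => rw [← ih, ← hf (-(i:ℤ) - 1)]; congr 1; ring
  rw [key x, key y]

theorem zmod4_even {c : ℤ} : ((c : ZMod 4) = 1 ∨ (c : ZMod 4) = 3) ↔ Odd c := by
  have h1 : ((c : ZMod 4) = 1) ↔ c % 4 = 1 := by
    have := ZMod.intCast_eq_intCast_iff' c 1 4
    simpa using this
  have h3 : ((c : ZMod 4) = 3) ↔ c % 4 = 3 := by
    have := ZMod.intCast_eq_intCast_iff' c 3 4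
    simpa using this
  rw [h1, h3, Int.odd_iff]; omega

theorem zmod4_eq {c e : ℤ} : ((c : ZMod 4) = (e : ZMod 4)) ↔ c % 4 = e % 4 := by
  have := ZMod.intCast_eq_intCast_iff' c e 4
  simpa using this

theorem Good.d_step (g : Good k D h v) (x y : ℤ) (hy : Odd y) :
    (h (x+1) y).d = (h x y).d + 1 := by
  rcases Int.even_or_odd x with hx | hx
  · have := (g.bb x y hx hy).2.1
    rw [this]
  · exact (g.cc x y hx hy).1.1

theorem Good.colL (g : Good k D h v) (x y y' : ℤ) (hx : Odd x) (hy' : Odd y') :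
    (h (x+1) y').d = if (v x y).l = true then 3 else 1 := by
  have step : ∀ y, (v x (y+1)).l = (v x y).l := by
    intro y
    rcases Int.even_or_odd y with hy | hy
    · rw [(g.aa x y hx hy).2.1]
    · exact (g.cc x y hx hy).2.1.2.2.1
  have := const_of_step (fun y => (v x y).l) step y y'
  try simp only at this
  rw [this]
  exact (g.cc x y' hx hy').1.2.1

theorem Good.phase (g : Good k D h v) :
    ∃ c : ℤ, Even c ∧ ∀ x y, Odd y → (h (x+1) y).d = ((x + c : ℤ) : ZMod 4) := by
  obtain ⟨c, hc⟩ := ZMod.intCast_surjective ((h 1 1).d)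
  have row1 : ∀ x, (h (x+1) 1).d = ((x + c : ℤ) : ZMod 4) := by
    intro x
    have := const_of_step (fun x => (h (x+1) 1).d - (x : ZMod 4)) (by
      intro x
      try simp only
      rw [g.d_step (x+1) 1 odd_one]
      push_cast; ring) x 0
    simp only [Int.cast_zero, sub_zero, zero_add] at this
    push_cast
    rw [hc, ← this]; ring
  have oddrow : ∀ x y, Odd y → (h (x+1) y).d = ((x + c : ℤ) : ZMod 4) := by
    intro x y hy
    have e : (h (x+1) y).d - (x : ZMod 4) = (h (1+1) y).d - ((1:ℤ) : ZMod 4) := by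
      have := const_of_step (fun x => (h (x+1) y).d - (x : ZMod 4)) (by
        intro x
        try simp only
        rw [g.d_step (x+1) y hy]
        push_cast; ring) x 1
      exact this
    have e1 := g.colL 1 0 y odd_one hy
    have e2 := g.colL 1 0 1 odd_one odd_one
    have e3 : (h (1+1) y).d = (h (1+1) 1).d := by rw [e1, e2]
    rw [e3, row1 1] at e
    push_cast at e ⊢
    linear_combination e
  refine ⟨c, ?_, oddrow⟩
  have e2 := g.colL 1 0 1 odd_one odd_one
  rw [row1 1] at e2
  have : Odd (1 + c) := by
    rw [← zmod4_even, e2]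
    split_ifs <;> simp
  rw [Int.odd_iff] at this
  rw [Int.even_iff]; omega

/-- Both phases are normalised. -/
structure Good0 (k : ℕ) (D : DatRule α β) (h : ℤ → ℤ → Line α) (v : ℤ → ℤ → Line β) : Prop
    extends Good k D h v where
  hd : ∀ x y, Odd y → (h (x+1) y).d = (x : ZMod 4)
  vd : ∀ x y, Odd x → (v x (y+1)).d = (y : ZMod 4)

theorem Good0.symm (g : Good0 k D h v) : Good0 k D.symm (fun x y => v y x) (fun x y => h y x) where
  toGood := g.toGood.symm
  hd x y hy := g.vd y x hy
  vd x y hx := g.hd y x hx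

theorem Good.normalise (g : Good k D h v) :
    ∃ p q : ℤ, Even p ∧ Even q ∧
      Good0 k D (fun x y => h (x + p) (y + q)) (fun x y => v (x + p) (y + q)) := by
  obtain ⟨c, hc, hc'⟩ := g.phase
  obtain ⟨e, he, he'⟩ := g.symm.phase
  refine ⟨-c, -e, hc.neg, he.neg, g.shift _ _ hc.neg he.neg, ?_, ?_⟩
  · intro x y hy
    have := hc' (x - c) (y - e) (hy.sub_even he)
    convert this using 2
    · congr 1; ring
    · ring
  · intro x y hx
    have := he' (y - e) (x - c) (hx.sub_even hc)
    try simp only at this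
    convert this using 2
    · congr 1; ring
    · ring

theorem Good0.h2 (g : Good0 k D h v) (x y : ℤ) : h (2*(x+1)) (2*y) = h (2*x+1) (2*y) := by
  have := (g.aa (2*x+1) (2*y) (by simp) (by simp)).1
  rw [← this]; congr 1; ring

theorem Good0.hodd (g : Good0 k D h v) (X Y : ℤ) (hY : Odd Y) :
    ((h (2*X) (2*Y)).d = 1 ∨ (h (2*X) (2*Y)).d = 3) ↔ Even X := by
  have ho : Odd (2*X-1) := ⟨X-1, by ring⟩
  have ta := g.aa (2*X-1) (2*Y) ho (by simp)
  have e0 : (v (2*X-1) (2*Y+1)).d = 2 := by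
    rw [g.vd _ _ ho]
    have := (zmod4_eq (c := 2*Y) (e := 2)).2 (by rw [Int.odd_iff] at hY; omega)
    simpa using this
  have eE : h (2*X) (2*Y) = h (2*X-1) (2*Y) := by
    rw [← ta.1]; congr 1; ring
  rw [eE]
  rcases ta.2.2 with hh | hh
  · rw [e0] at hh; exact absurd hh (by decide)
  · rw [← hh.2.1]
    have cl := g.colL (2*X-1) (2*Y) 1 ho odd_one
    rw [g.hd _ _ odd_one] at cl
    rw [Int.even_iff]
    split_ifs at cl with hl
    · refine iff_of_true hl ?_
      have := (zmod4_eq (c := 2*X-1) (e := 3)).1 (by simpa using cl)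
      omega
    · refine iff_of_false hl ?_
      have := (zmod4_eq (c := 2*X-1) (e := 1)).1 (by simpa using cl)
      omega

theorem Good0.type2 (g : Good0 k D h v) (X Y : ℤ) (hY : Odd Y) :
    (Odd X → TC D (h (2*X) (2*Y)) (v (2*X) (2*Y)) (h (2*X+1) (2*Y)) (v (2*X) (2*Y+1))) ∧
    (Even X → TB (h (2*X) (2*Y)) (v (2*X) (2*Y)) (h (2*X+1) (2*Y)) (v (2*X) (2*Y+1))) := by
  have e1 := g.hodd X Y hY
  have e2 := g.hodd (X+1) Y hY
  rw [g.h2] at e2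
  rcases g.tile (2*X) (2*Y) with t | t | t
  · rw [t.1, e1] at e2
    rw [Int.even_iff, Int.even_iff] at e2
    omega
  · refine ⟨fun hX => ?_, fun _ => t⟩
    exfalso
    have : Even (X+1) := hX.add_one
    rw [← e2] at this
    rcases t.2.2 with hh | ⟨hh, _⟩ <;> rw [hh] at this <;> revert this <;> decide
  · refine ⟨fun _ => t, fun hX => ?_⟩
    exfalso
    have : ¬ Even (X+1) := by rw [Int.even_iff] at *; omega
    rw [← e2, t.1.2.1] at this
    split_ifs at this <;> simp at this

theorem Tile.vb {W : Line α} {S : Line β} {E : Line α} {N : Line β}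
    (t : Tile D W S E N) : N.b = S.b := by
  rcases t with t | t | t
  · rw [t.2.1]
  · rw [t.1]
  · exact t.2.1.2.2.2.1

theorem floor_jump (n a : ℤ) (hn : 0 < n) (b : ℤ) (hb : b = a + 2) (h2 : 2 ∣ n) (ha : 2 ∣ a) :
    b / n = a / n + if n ∣ b then 1 else 0 := by
  subst hb
  obtain ⟨m, rfl⟩ := h2
  obtain ⟨c, rfl⟩ := ha
  have hm : 0 < m := by omega
  have e : (2 * c + 2 : ℤ) = 2 * (c + 1) := by ring
  rw [e, Int.mul_ediv_mul_of_pos _ _ (by norm_num), Int.mul_ediv_mul_of_pos _ _ (by norm_num)]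
  simp only [Int.mul_dvd_mul_iff_left (show (2:ℤ) ≠ 0 by norm_num)]
  split_ifs with hd
  · obtain ⟨q, hq⟩ := hd
    have : c = m * q - 1 := by omega
    rw [hq, Int.mul_ediv_cancel_left _ hm.ne']
    rw [eq_comm, ← eq_sub_iff_add_eq, this]
    rw [Int.ediv_eq_iff_of_pos hm]
    constructor <;> nlinarith
  · rw [add_zero, Int.ediv_eq_iff_of_pos hm]
    have h1 := Int.emod_add_mul_ediv c m
    have h2 := Int.emod_nonneg c hm.ne'
    have h3 := Int.emod_lt_of_pos c hm
    constructor
    · nlinarith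
    · rcases (show c % m + 1 < m ∨ c % m + 1 = m by omega) with h | h
      · nlinarith
      · exact absurd ⟨c / m + 1, by rw [mul_add]; linarith⟩ hd

theorem Good0.colb2 (g : Good0 k D h v) :
    ∃ o, Odd o ∧ ∀ x y, Odd x → ((v (2*x) (2*y)).b = true ↔ (2^(k+1+1) : ℤ) ∣ x - o) := by
  obtain ⟨o, ho, hb⟩ := g.colb
  set n : ℤ := 2^(k+1) with hn
  have hnpos : 0 < n := by positivity
  have hn2 : 2 ∣ n := ⟨2^k, by rw [hn]; ring⟩
  -- the counter in row 1
  have hs : ∀ j : ℤ, (h (2*(j+1)) 1).s = (h (2*j) 1).s + if n ∣ 2*j+1-o then 1 else 0 := by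
    intro j
    have t1 := g.bb (2*j) 1 (by simp) odd_one
    have t2 := g.cc (2*j+1) 1 (by simp) odd_one
    have e := t2.1.2.2.2.2.1
    rw [show 2*j+1+1 = 2*(j+1) by ring] at e
    rw [e, t1.2.1]
    simp only [hb _ _ (show Odd (2*j+1) by simp)]
  obtain ⟨σ, hσ⟩ := ZMod.intCast_surjective ((h (2*0) 1).s - (((-1-o)/n : ℤ) : ZMod 4))
  have hform : ∀ j : ℤ, (h (2*j) 1).s = ((σ + (2*j-1-o)/n : ℤ) : ZMod 4) := by
    intro j
    have := const_of_step (fun j : ℤ => (h (2*j) 1).s - (((2*j-1-o)/n : ℤ) : ZMod 4)) (by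
      intro j
      try simp only
      rw [hs, floor_jump n (2*j-1-o) hnpos (2*(j+1)-1-o) (by ring) hn2
        (by obtain ⟨q, rfl⟩ := ho; exact ⟨j - q - 1, by ring⟩)]
      rw [show 2*(j+1)-1-o = 2*j+1-o by ring]
      push_cast
      split_ifs <;> simp) j 0
    simp only [mul_zero, zero_sub] at this hσ
    rw [← hσ] at this
    push_cast
    linear_combination this
  have hvb : ∀ x y, (v x y).b = (v x 1).b := fun x y =>
    const_of_step (fun y => (v x y).b) (fun y => (g.tile x y).vb) y 1
  obtain ⟨m, hm⟩ := ho
  obtain ⟨n', hn'⟩ := hn2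
  -- the new origin
  set o' : ℤ := 1 + m - n' * σ with ho'
  have key : ∀ x : ℤ, (n ∣ 2*x-1-o ∧ (h (2*x) 1).s = 0) ↔ (2 * n : ℤ) ∣ x - o' := by
    intro x
    rw [hform]
    constructor
    · rintro ⟨⟨q, hq⟩, h0⟩
      rw [hq, Int.mul_ediv_cancel_left _ hnpos.ne'] at h0
      have := (zmod4_eq (c := σ+q) (e := 0)).1 (by simpa using h0)
      obtain ⟨p, hp⟩ : (4:ℤ) ∣ σ + q := by omega
      refine ⟨p, ?_⟩
      have hq' : q = 4*p - σ := by linarith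
      subst hq'
      have : 2*(x - o') = 2*(2*n*p) := by
        rw [ho']
        have : 2*x - 1 - o - n * (4*p-σ) = 0 := by linarith
        rw [hm] at this
        linear_combination this - σ * hn'
      linarith
    · rintro ⟨p, hp⟩
      have e : 2*x-1-o = n * (4*p-σ) := by
        rw [ho'] at hp
        linear_combination 2*hp - hm + σ * hn'
      refine ⟨⟨_, e⟩, ?_⟩
      rw [e, Int.mul_ediv_cancel_left _ hnpos.ne']
      have := (zmod4_eq (c := σ+(4*p-σ)) (e := 0)).2 (by omega)
      simpa using this
  have hodd : Odd o' := by
    obtain ⟨k1, k2⟩ := (key o').2 (by simp)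
    have hx : Odd (2*o'-1) := ⟨o'-1, by ring⟩
    have t := g.cc (2*o'-1) 1 hx odd_one
    rw [show 2*o'-1+1 = 2*o' by ring] at t
    have hl := t.1.2.2.2.2.2.2 ((hb _ _ hx).2 k1) k2
    have e := t.1.2.1
    rw [hl] at e
    have e2 := g.hd (2*o'-1) 1 odd_one
    rw [show 2*o'-1+1 = 2*o' by ring, e] at e2
    have := (zmod4_eq (c := 1) (e := 2*o'-1)).1 (by simpa using e2)
    rw [Int.odd_iff]; omega
  refine ⟨o', hodd, fun x y hx => ?_⟩
  rw [hvb, show (2^(k+1+1) : ℤ) = 2 * n by rw [hn]; ring, ← key]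
  have tb := g.bb (2*x) 1 (by simp) odd_one
  have hx' : Odd (2*x-1) := ⟨x-1, by ring⟩
  have tc := g.cc (2*x-1) 1 hx' odd_one
  rw [show 2*x-1+1 = 2*x by ring] at tc
  have hr := tc.1.2.2.2.2.2.1
  have d2 := g.hd (2*x) 1 odd_one
  rcases tb.2.2 with hh | hh
  · rw [d2] at hh
    have := (zmod4_eq (c := 2*x) (e := 0)).1 (by simpa using hh)
    rw [Int.odd_iff] at hx; omega
  · rw [hh.2.2, hr, hb _ _ hx']

theorem Good0.double (g : Good0 k D h v) :
    Good (k+1) D (fun x y => h (2*x) (2*y)) (fun x y => v (2*x) (2*y)) where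
  cc x y hx hy := by
    have := (g.type2 x y hy).1 hx
    try simp only
    rw [g.h2, g.symm.h2 y x]
    exact this
  aa x y hx hy := by
    have := (g.symm.type2 y x hx).2 hy
    try simp only at this ⊢
    rw [g.h2, g.symm.h2 y x]
    exact this
  bb x y hx hy := by
    have := (g.type2 x y hy).2 hx
    try simp only
    rw [g.h2, g.symm.h2 y x]
    exact this
  tile x y := by
    try simp only
    rw [g.h2, g.symm.h2 y x]
    exact g.tile _ _
  colb := g.colb2
  rowb := by
    obtain ⟨o, ho, h⟩ := g.symm.colb2
    exact ⟨o, ho, fun x y hy => h y x hy⟩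

theorem Good.all (g : Good 0 D h v) : ∀ k, ∃ h' v', Good k D h' v' := by
  intro k
  induction k with
  | zero => exact ⟨h, v, g⟩
  | succ k ih =>
    obtain ⟨h', v', g'⟩ := ih
    obtain ⟨p, q, _, _, g0⟩ := g'.normalise
    exact ⟨_, _, g0.double⟩

theorem Good.extract (g : Good k D h v) :
    ∃ (H : ℕ → ℕ → α) (V : ℕ → ℕ → β), ∀ i j, i < 2^k → j < 2^k →
      D (decide (i = 0)) (decide (j = 0)) (H i j) (V i j) (H (i+1) j) (V i (j+1)) := by
  obtain ⟨o, ho, hb⟩ := g.colb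
  obtain ⟨o', ho', hb'⟩ := g.rowb
  refine ⟨fun i j => (h (o+2*i) (o'+2*j)).dat, fun i j => (v (o+2*i) (o'+2*j)).dat, ?_⟩
  intro i j hi hj
  have hx : Odd (o + 2*(i:ℤ)) := ho.add_even (by simp)
  have hy : Odd (o' + 2*(j:ℤ)) := ho'.add_even (by simp)
  have tc := (g.cc _ _ hx hy).2.2
  have hdec : ∀ i : ℕ, i < 2^k → ∀ b : Bool, (b = true ↔ (2^(k+1) : ℤ) ∣ 2*(i:ℤ)) → b = decide (i = 0) := by
    intro i hi b hb
    rw [Bool.eq_iff_iff, hb, decide_eq_true_iff, pow_succ', Int.mul_dvd_mul_iff_left (by norm_num)]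
    constructor
    · intro hd
      have : 2^k ∣ i := by exact_mod_cast hd
      exact Nat.eq_zero_of_dvd_of_lt this hi
    · rintro rfl; simp
  have e1 := hdec i hi (v (o+2*i) (o'+2*j)).b (by rw [hb _ _ hx]; simp)
  have e2 := hdec j hj (h (o+2*i) (o'+2*j)).b (by rw [hb' _ _ hy]; simp)
  have e3 : (h (o+2*i+1) (o'+2*j)).dat = (h (o+2*((i+1:ℕ):ℤ)) (o'+2*j)).dat := by
    have := (g.bb (o+2*i+1) (o'+2*j) hx.add_one hy).2.1
    rw [show o+2*((i+1:ℕ):ℤ) = o+2*i+1+1 by push_cast; ring, this]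
  have e4 : (v (o+2*i) (o'+2*j+1)).dat = (v (o+2*i) (o'+2*((j+1:ℕ):ℤ))).dat := by
    have := (g.aa (o+2*i) (o'+2*j+1) hx hy.add_one).2.1
    rw [show o'+2*((j+1:ℕ):ℤ) = o'+2*j+1+1 by push_cast; ring, this]
  rw [e1, e2, e3, e4] at tc
  exact tc

end
/-! ### Soundness of the full hierarchical rule -/

def FullTile {α β : Type} (D : DatRule α β) (W : Line α × Bool × Bool) (S : Line β × Bool × Bool)
    (E : Line α × Bool × Bool) (N : Line β × Bool × Bool) : Prop :=
  S.2 = W.2 ∧ E.2 = (!W.2.1, W.2.2) ∧ N.2 = (W.2.1, !W.2.2) ∧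
  Tile D W.1 S.1 E.1 N.1 ∧
  (W.2 = (true, true) → TC D W.1 S.1 E.1 N.1) ∧
  (W.2 = (true, false) → TA W.1 S.1 E.1 N.1) ∧
  (W.2 = (false, true) → TB W.1 S.1 E.1 N.1) ∧
  (W.2.1 = true → S.1.b = true) ∧ (W.2.2 = true → W.1.b = true)

theorem decide_odd_succ (x : ℤ) : decide (Odd (x+1)) = !decide (Odd x) := by
  have : Odd (x+1) ↔ ¬ Odd x := by rw [Int.odd_iff, Int.odd_iff]; omega
  by_cases h : Odd x
  · rw [decide_eq_true h, decide_eq_false (fun h' => this.1 h' h)]; rfl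
  · rw [decide_eq_false h, decide_eq_true (this.2 h)]; rfl

theorem parity_of_flip (f : ℤ → Bool) (hf : ∀ x, f (x + 1) = !f x) :
    ∃ p : ℤ, ∀ x, f (x + p) = decide (Odd x) := by
  have key : ∀ x, f x = (f 0 ^^ decide (Odd x)) := by
    intro x
    have := const_of_step (fun x => (f x ^^ decide (Odd x))) (by
      intro x
      simp only [hf, decide_odd_succ]
      by_cases hx : Odd x <;> simp [hx]) x 0
    try simp only at this
    by_cases hx : Odd x <;> simp [hx] at this ⊢ <;> simp [← this]
  by_cases h0 : f 0 = true
  · refine ⟨1, fun x => ?_⟩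
    rw [key, h0]
    rw [decide_odd_succ]; simp
  · refine ⟨0, fun x => ?_⟩
    rw [key]; simp [h0]

theorem full_sound {α β : Type} {D : DatRule α β} (h : ℤ → ℤ → Line α × Bool × Bool)
    (v : ℤ → ℤ → Line β × Bool × Bool)
    (ht : ∀ x y, FullTile D (h x y) (v x y) (h (x+1) y) (v x (y+1))) (k : ℕ) :
    ∃ (H : ℕ → ℕ → α) (V : ℕ → ℕ → β), ∀ i j, i < 2^k → j < 2^k →
      D (decide (i = 0)) (decide (j = 0)) (H i j) (V i j) (H (i+1) j) (V i (j+1)) := by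
  have px : ∀ x y, (h (x+1) y).2 = (!(h x y).2.1, (h x y).2.2) := fun x y => (ht x y).2.1
  have py : ∀ x y, (h x (y+1)).2 = ((h x y).2.1, !(h x y).2.2) := fun x y => by
    rw [← (ht x (y+1)).1]; exact (ht x y).2.2.1
  obtain ⟨p, hp⟩ := parity_of_flip (fun x => (h x 0).2.1) (fun x => by simp [px])
  obtain ⟨q, hq⟩ := parity_of_flip (fun y => (h 0 y).2.2) (fun x => by simp [py])
  have hpar : ∀ x y, (h (x+p) (y+q)).2 = (decide (Odd x), decide (Odd y)) := by
    intro x y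
    have e1 := const_of_step (fun y => (h (x+p) y).2.1) (fun y => by simp [py]) (y+q) 0
    have e2 := const_of_step (fun x => (h x (y+q)).2.2) (fun y => by simp [px]) (x+p) 0
    have e3 := hp x
    have e4 := hq y
    try simp only at e1 e2 e3 e4
    ext
    · rw [e1, e3]
    · rw [e2, e4]
  have g : Good 0 D (fun x y => (h (x+p) (y+q)).1) (fun x y => (v (x+p) (y+q)).1) := by
    have ht' : ∀ x y, FullTile D (h (x+p) (y+q)) (v (x+p) (y+q)) (h (x+1+p) (y+q))
        (v (x+p) (y+1+q)) := by
      intro x y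
      have := ht (x+p) (y+q)
      rwa [add_right_comm x p 1, add_right_comm y q 1] at this
    refine ⟨?_, ?_, ?_, ?_, ?_, ?_⟩
    · intro x y hx hy
      exact (ht' x y).2.2.2.2.1 (by rw [hpar]; simp [hx, hy])
    · intro x y hx hy
      exact (ht' x y).2.2.2.2.2.1 (by rw [hpar]; simpa [hx] using hy)
    · intro x y hx hy
      exact (ht' x y).2.2.2.2.2.2.1 (by rw [hpar]; simpa [hy] using hx)
    · intro x y
      exact (ht' x y).2.2.2.1
    · refine ⟨1, odd_one, fun x y hx => iff_of_true ?_ ?_⟩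
      · exact (ht' x y).2.2.2.2.2.2.2.1 (by rw [hpar]; simp [hx])
      · obtain ⟨m, rfl⟩ := hx; simp
    · refine ⟨1, odd_one, fun x y hx => iff_of_true ?_ ?_⟩
      · exact (ht' x y).2.2.2.2.2.2.2.2 (by rw [hpar]; simp [hx])
      · obtain ⟨m, rfl⟩ := hx; simp
  obtain ⟨h', v', g'⟩ := g.all k
  exact g'.extract

/-! ### Completeness: the explicit tiling -/

def line {α : Type} (k : ℕ) (z0 : ℤ) (f : ℕ → α) (z : ℤ) : Line α where
  d := (z : ZMod 4)
  l := decide (z0 % 4 = 3)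
  b := decide ((2^(k+1) : ℤ) ∣ z0 - 1)
  s := (((z-1)/2/2^k : ℤ) : ZMod 4)
  r := decide ((2^k : ℤ) ∣ (z-1)/2)
  dat := f (((z-1)/2) % 2^k).toNat

theorem dvd_and_quot (k : ℕ) (I : ℤ) :
    ((2^k : ℤ) ∣ I ∧ ((I/2^k : ℤ) : ZMod 4) = 0) ↔ (2^(k+2) : ℤ) ∣ I := by
  constructor
  · rintro ⟨⟨q, rfl⟩, h⟩
    rw [Int.mul_ediv_cancel_left _ (by positivity)] at h
    have := (zmod4_eq (c := q) (e := 0)).1 (by simpa using h)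
    obtain ⟨p, rfl⟩ : (4:ℤ) ∣ q := by omega
    exact ⟨p, by ring⟩
  · rintro ⟨p, rfl⟩
    refine ⟨⟨4*p, by ring⟩, ?_⟩
    rw [show (2^(k+2) * p : ℤ) = 2^k * (4*p) by ring, Int.mul_ediv_cancel_left _ (by positivity)]
    have := (zmod4_eq (c := 4*p) (e := 0)).2 (by omega)
    simpa using this

theorem line_wrap {α β : Type} (k : ℕ) (z0 : ℤ) (f : ℕ → α) (z : ℤ) (hz : z % 2 = 0) (P : Line β)
    (hP : z % 4 = 2 → ((z0 % 4 = 3 ↔ (P.d = 1 ∨ P.d = 3)) ∧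
      (P.b = true ↔ (2^(k+2) : ℤ) ∣ z/2 - 1))) :
    Wrap (line k z0 f (z-1)) (line k z0 f z) P := by
  have e : (z - 1 - 1)/2 = (z-1)/2 := by omega
  refine ⟨?_, ?_⟩
  · simp only [line, e]
    congr 1
    push_cast; ring
  · by_cases h : z % 4 = 2
    · right
      have hd : (z : ZMod 4) = 2 := by
        have := (zmod4_eq (c := z) (e := 2)).2 (by omega)
        simpa using this
      obtain ⟨h1, h2⟩ := hP h
      refine ⟨hd, ?_, ?_⟩
      · rw [← h1]; simp [line]
      · rw [h2, ← dvd_and_quot]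
        simp only [line, e, decide_eq_true_iff]
        rw [show z/2 - 1 = (z-1)/2 by omega]
    · left
      have := (zmod4_eq (c := z) (e := 0)).2 (by omega)
      simpa [line] using this

theorem floor_jump1 (k : ℕ) (I : ℤ) :
    I / 2^k = (I-1) / 2^k + if (2^k : ℤ) ∣ I then 1 else 0 := by
  have := floor_jump (2 * 2^k) (2*I-2) (by positivity) (2*I) (by ring) (by simp)
    (by exact ⟨I-1, by ring⟩)
  rw [Int.mul_ediv_mul_of_pos _ _ (by norm_num), show 2*I-2 = 2*(I-1) by ring,
    Int.mul_ediv_mul_of_pos _ _ (by norm_num)] at this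
  simpa only [Int.mul_dvd_mul_iff_left (show (2:ℤ) ≠ 0 by norm_num)] using this

theorem border_iff (k : ℕ) (z : ℤ) (hz : z % 2 = 1) :
    (2^(k+1) : ℤ) ∣ z - 1 ↔ (2^k : ℤ) ∣ (z-1)/2 := by
  obtain ⟨m, hm⟩ : ∃ m, z = 2*m+1 := ⟨z/2, by omega⟩
  subst hm
  rw [show (2*m+1-1 : ℤ) = 2*m by ring, pow_succ', Int.mul_dvd_mul_iff_left (by norm_num)]
  simp

theorem line_act {α β : Type} (k : ℕ) (z0 : ℤ) (f : ℕ → α) (z : ℤ) (hz : z % 2 = 1) (P : Line β)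
    (hl : P.l = decide (z % 4 = 3)) (hb : P.b = decide ((2^(k+1) : ℤ) ∣ z - 1)) :
    Act (line k z0 f (z-1)) (line k z0 f z) P := by
  have e : (z - 1 - 1)/2 = (z-1)/2 - 1 := by omega
  refine ⟨?_, ?_, rfl, rfl, ?_, ?_, ?_⟩
  · simp [line]
  · simp only [line, hl, decide_eq_true_iff]
    split_ifs with h
    · have := (zmod4_eq (c := z) (e := 3)).2 (by omega)
      simpa using this
    · have := (zmod4_eq (c := z) (e := 1)).2 (by omega)
      simpa using this
  · simp only [line, hb, decide_eq_true_iff, e, border_iff k z hz]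
    rw [floor_jump1 k ((z-1)/2)]
    push_cast
    split_ifs <;> simp
  · rw [hb]; simp only [line, border_iff k z hz]
  · intro h1 h2
    rw [hb, decide_eq_true_iff, border_iff k z hz] at h1
    have := (dvd_and_quot k ((z-1)/2)).1 ⟨h1, h2⟩
    rw [hl, decide_eq_false_iff_not]
    obtain ⟨q, hq⟩ := this
    rw [pow_add] at hq
    have : (z-1)/2 = 4 * (2^k * q) := by rw [hq]; ring
    omega

def lev (x : ℤ) : ℕ := padicValInt 2 x

theorem lev_dvd {x : ℤ} (hx : x ≠ 0) (j : ℕ) : (2^j : ℤ) ∣ x ↔ j ≤ lev x := by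
  have := padicValInt_dvd_iff (p := 2) j x
  simpa [hx, lev] using this

/-- the line at coordinate `o`, at the edge just after position `x` -/
def oline {α : Type} (o : ℤ) (f : ℕ → α) (x : ℤ) : Line α :=
  line (lev o) (o / 2^lev o) f (x / 2^lev o)

theorem div_pass (k : ℕ) (x : ℤ) (hx : ¬ (2^k : ℤ) ∣ x) : (x-1)/2^k = x/2^k := by
  rw [floor_jump1 k x]; simp [hx]

theorem div_hit (k : ℕ) (x : ℤ) (hx : (2^k : ℤ) ∣ x) : (x-1)/2^k = x/2^k - 1 := by
  rw [floor_jump1 k x]; simp [hx]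

theorem oline_A {α β : Type} (x y : ℤ) (hx : x ≠ 0) (hy : y ≠ 0) (hlt : lev x < lev y)
    (f : ℕ → α) (g : ℕ → β) :
    TA (oline y f (x-1)) (oline x g (y-1)) (oline y f x) (oline x g y) := by
  have hn : ¬ (2^lev y : ℤ) ∣ x := by rw [lev_dvd hx]; omega
  refine ⟨by simp only [oline, div_pass _ _ hn], ?_⟩
  have hd : (2^(lev x + 1) : ℤ) ∣ y := by rw [lev_dvd hy]; omega
  obtain ⟨m, hm⟩ := hd
  have hy1 : y / 2^lev x = 2 * m := by
    rw [hm, pow_succ, mul_assoc, Int.mul_ediv_cancel_left _ (by positivity)]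
  simp only [oline]
  rw [div_hit (lev x) y ⟨2*m, by rw [hm]; ring⟩, hy1]
  apply line_wrap
  · omega
  intro h4
  have hlev : lev y = lev x + 1 := by
    by_contra hne
    have : (2^(lev x + 2) : ℤ) ∣ y := by rw [lev_dvd hy]; omega
    obtain ⟨q, hq⟩ := this
    have : y / 2^lev x = 4 * q := by
      rw [hq, pow_add, mul_assoc, Int.mul_ediv_cancel_left _ (by positivity)]; norm_num
    omega
  rw [hlev]
  rw [hlev] at hn
  have hxe : x = 2^lev x * (x / 2^lev x) :=
    (Int.mul_ediv_cancel' ((lev_dvd hx _).2 le_rfl)).symm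
  have hodd : (x / 2^lev x) % 2 = 1 := by
    by_contra hne
    apply hn
    obtain ⟨q, hq⟩ : (2:ℤ) ∣ x / 2^lev x := by omega
    exact ⟨q, by rw [pow_succ]; linear_combination hxe + 2^lev x * hq⟩
  have hdiv : x / 2^(lev x + 1) = (x / 2^lev x) / 2 := by
    rw [pow_succ, Int.ediv_ediv_of_nonneg (by positivity)]
  constructor
  · simp only [line]
    rw [zmod4_even, div_pass _ _ hn, hdiv, Int.odd_iff]
    omega
  · simp only [line, decide_eq_true_iff]
    rw [show 2 * m / 2 = m by omega, hm, Int.mul_ediv_cancel_left _ (by positivity)]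

theorem oline_act {α β : Type} (x y : ℤ) (hx : x ≠ 0) (hy : y ≠ 0) (he : lev x = lev y)
    (f : ℕ → α) (g : ℕ → β) :
    Act (oline y f (x-1)) (oline y f x) (oline x g (y-1)) := by
  have hd : (2^lev y : ℤ) ∣ x := by rw [lev_dvd hx]; omega
  simp only [oline]
  rw [div_hit _ x hd, he]
  refine line_act _ _ _ _ ?_ _ rfl rfl
  by_contra hne
  obtain ⟨q, hq⟩ : (2:ℤ) ∣ x / 2^lev y := by omega
  have hxe : x = 2^lev y * (x / 2^lev y) := (Int.mul_ediv_cancel' hd).symm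
  have : (2^(lev y + 1) : ℤ) ∣ x := by
    rw [hxe, hq]; exact ⟨q, by simp only [pow_succ]; ring_nf⟩
  rw [lev_dvd hx] at this
  omega

theorem oline_zero {α β : Type} (x : ℤ) (f : ℕ → α) (P : Line β) :
    Wrap (oline x f (0-1)) (oline x f 0) P := by
  simp only [oline]
  rw [div_hit (lev x) 0 (by simp)]
  refine line_wrap _ _ _ _ (by simp) _ ?_
  intro h; simp at h

/-- index in the block -/
def bidx (x : ℤ) : ℕ := (((x / 2^lev x) - 1) / 2 % 2^lev x).toNat

theorem odd_part (x : ℤ) (hx : x ≠ 0) : (x / 2^lev x) % 2 = 1 := by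
  by_contra hne
  obtain ⟨q, hq⟩ : (2:ℤ) ∣ x / 2^lev x := by omega
  have hxe : x = 2^lev x * (x / 2^lev x) :=
    (Int.mul_ediv_cancel' ((lev_dvd hx _).2 le_rfl)).symm
  have : (2^(lev x + 1) : ℤ) ∣ x := by
    exact ⟨q, by rw [pow_succ]; linear_combination hxe + 2^lev x * hq⟩
  rw [lev_dvd hx] at this
  omega

theorem oline_b {β : Type} (x : ℤ) (hx : x ≠ 0) (g : ℕ → β) (y : ℤ) :
    (oline x g y).b = decide (bidx x = 0) := by
  simp only [oline, line, bidx, border_iff _ _ (odd_part x hx)]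
  congr 1
  rw [Int.toNat_eq_zero, Int.dvd_iff_emod_eq_zero]
  have := Int.emod_nonneg ((x / 2 ^ lev x - 1) / 2) (show (2^lev x : ℤ) ≠ 0 by positivity)
  apply propext
  constructor <;> intro h <;> omega

theorem oline_dat {α : Type} (x y : ℤ) (he : lev x = lev y) (f : ℕ → α) :
    (oline y f x).dat = f (bidx x) := by
  simp only [oline, line, bidx, he]

theorem oline_dat' {α : Type} (x y : ℤ) (hx : x ≠ 0) (he : lev x = lev y) (f : ℕ → α)
    (hi : bidx x ≠ 0) : ∃ i, bidx x = i + 1 ∧ (oline y f (x-1)).dat = f i := by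
  refine ⟨bidx x - 1, by omega, ?_⟩
  simp only [oline, line]
  have hd : (2^lev y : ℤ) ∣ x := by rw [lev_dvd hx]; omega
  rw [div_hit _ x hd, ← he]
  congr 1
  have ho := odd_part x hx
  unfold bidx at hi ⊢
  set z := x / 2^lev x
  have e : (z - 1 - 1)/2 = (z-1)/2 - 1 := by omega
  rw [e]
  set I := (z-1)/2
  set n : ℤ := 2^lev x with hn
  have hnp : 0 < n := by positivity
  have h1 : 0 ≤ I % n := Int.emod_nonneg _ hnp.ne'
  have h2 := Int.emod_lt_of_pos I hnp
  have h3 : (I - 1) % n = I % n - 1 := by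
    rw [Int.sub_emod, Int.emod_eq_of_lt (a := I % n - 1 % n)]
    · rw [Int.emod_eq_of_lt (a := 1)] <;> omega
    · rw [Int.emod_eq_of_lt (a := 1)] <;> omega
    · rw [Int.emod_eq_of_lt (a := 1)] <;> omega
  rw [h3]; omega

def defLine {α : Type} (d : ZMod 4) (a : α) : Line α := ⟨d, false, false, 0, false, a⟩

section
variable {α β : Type} (H : ℕ → ℕ → α) (V : ℕ → ℕ → β)

def hLine (x y : ℤ) : Line α :=
  if y = 0 then defLine 0 (H 0 0) else oline y (fun i => H (i+1) (bidx y)) (x-1)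

def vLine (x y : ℤ) : Line β :=
  if x = 0 then defLine (if y ≤ 0 then 3 else 0) (V 0 0)
  else oline x (fun j => V (bidx x) (j+1)) (y-1)

theorem lev_odd {x : ℤ} : Odd x ↔ (x ≠ 0 ∧ lev x = 0) := by
  constructor
  · intro h
    have hx : x ≠ 0 := by rintro rfl; simp at h
    refine ⟨hx, ?_⟩
    by_contra hne
    have := (lev_dvd hx 1).2 (by omega)
    rw [Int.odd_iff] at h
    omega
  · rintro ⟨hx, h0⟩
    by_contra hne
    have := (lev_dvd hx 1).1 (by rw [Int.not_odd_iff_even, Int.even_iff] at hne; omega)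
    omega

theorem bidx_odd {x : ℤ} (h : lev x = 0) : bidx x = 0 := by
  simp [bidx, h]

theorem full_complete (D : DatRule α β)
    (hD : ∀ i j w s, (i ≠ 0 → w = H i j) → (j ≠ 0 → s = V i j) →
      D (decide (i = 0)) (decide (j = 0)) w s (H (i+1) j) (V i (j+1))) (x y : ℤ) :
    FullTile D (hLine H x y, decide (Odd x), decide (Odd y))
      (vLine V x y, decide (Odd x), decide (Odd y))
      (hLine H (x+1) y, decide (Odd (x+1)), decide (Odd y))
      (vLine V x (y+1), decide (Odd x), decide (Odd (y+1))) := by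
  have hA : (y = 0 ∨ x ≠ 0 ∧ lev x < lev y) →
      TA (hLine H x y) (vLine V x y) (hLine H (x+1) y) (vLine V x (y+1)) := by
    intro h
    by_cases hy : y = 0
    · subst hy
      refine ⟨by simp [hLine], ?_⟩
      by_cases hx : x = 0
      · subst hx
        simp only [vLine, if_true, defLine]
        refine ⟨?_, Or.inl (by simp)⟩
        simp only [le_refl, if_true]
        congr 1
      · have := oline_zero x (fun j => V (bidx x) (j+1)) (hLine H x 0)
        simpa only [vLine, hx, if_false, zero_add, sub_self] using this
    · obtain ⟨hx, h⟩ := h.resolve_left hy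
      have := oline_A x y hx hy h (fun i => H (i+1) (bidx y)) (fun j => V (bidx x) (j+1))
      simpa only [vLine, hLine, hx, hy, if_false, add_sub_cancel_right] using this
  have hB : (y ≠ 0 ∧ (x = 0 ∨ lev y < lev x)) →
      TB (hLine H x y) (vLine V x y) (hLine H (x+1) y) (vLine V x (y+1)) := by
    rintro ⟨hy, h⟩
    by_cases hx : x = 0
    · subst hx
      refine ⟨?_, ?_⟩
      · simp only [vLine, if_true]
        congr 1
        by_cases h0 : y ≤ 0
        · rw [if_pos h0, if_pos (by omega)]
        · rw [if_neg h0, if_neg (by omega)]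
      · have := oline_zero y (fun i => H (i+1) (bidx y)) (vLine V 0 y)
        simpa only [hLine, hy, if_false, zero_add, sub_self] using this
    · have := oline_A y x hy hx (h.resolve_left hx) (fun j => V (bidx x) (j+1))
        (fun i => H (i+1) (bidx y))
      have : TB _ _ _ _ := this
      simpa only [vLine, hLine, hx, hy, if_false, add_sub_cancel_right] using this
  have hC : (y ≠ 0 ∧ x ≠ 0 ∧ lev x = lev y) →
      TC D (hLine H x y) (vLine V x y) (hLine H (x+1) y) (vLine V x (y+1)) := by
    rintro ⟨hy, hx, he⟩
    have t1 := oline_act x y hx hy he (fun i => H (i+1) (bidx y)) (fun j => V (bidx x) (j+1))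
    have t2 := oline_act y x hy hx he.symm (fun j => V (bidx x) (j+1)) (fun i => H (i+1) (bidx y))
    have t3 : TC D (oline y (fun i => H (i+1) (bidx y)) (x-1)) (oline x (fun j => V (bidx x) (j+1)) (y-1))
       (oline y (fun i => H (i+1) (bidx y)) x) (oline x (fun j => V (bidx x) (j+1)) y) := by
      refine ⟨t1, t2, ?_⟩
      rw [oline_b x hx, oline_b y hy, oline_dat x y he, oline_dat y x he.symm]
      apply hD
      · intro hi
        obtain ⟨i, hi1, hi2⟩ := oline_dat' x y hx he (fun i => H (i+1) (bidx y)) hi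
        rw [hi2, hi1]
      · intro hi
        obtain ⟨i, hi1, hi2⟩ := oline_dat' y x hy he.symm (fun j => V (bidx x) (j+1)) hi
        rw [hi2, hi1]
    simpa only [vLine, hLine, hx, hy, if_false, add_sub_cancel_right] using t3
  refine ⟨rfl, ?_, ?_, ?_, ?_, ?_, ?_, ?_, ?_⟩
  · simp only [decide_odd_succ]
  · simp only [decide_odd_succ]
  · by_cases hy : y = 0
    · exact Or.inl (hA (Or.inl hy))
    by_cases hx : x = 0
    · exact Or.inr (Or.inl (hB ⟨hy, Or.inl hx⟩))
    rcases lt_trichotomy (lev x) (lev y) with h | h | h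
    · exact Or.inl (hA (Or.inr ⟨hx, h⟩))
    · exact Or.inr (Or.inr (hC ⟨hy, hx, h⟩))
    · exact Or.inr (Or.inl (hB ⟨hy, Or.inr h⟩))
  · intro h
    simp only [Prod.mk.injEq, decide_eq_true_iff, lev_odd] at h
    exact hC ⟨h.2.1, h.1.1, by omega⟩
  · intro h
    simp only [Prod.mk.injEq, decide_eq_true_iff, decide_eq_false_iff_not, lev_odd] at h
    apply hA
    by_cases hy : y = 0
    · exact Or.inl hy
    · exact Or.inr ⟨h.1.1, by have := fun h' => h.2 ⟨hy, h'⟩; omega⟩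
  · intro h
    simp only [Prod.mk.injEq, decide_eq_true_iff, decide_eq_false_iff_not, lev_odd] at h
    apply hB
    refine ⟨h.2.1, ?_⟩
    by_cases hx : x = 0
    · exact Or.inl hx
    · exact Or.inr (by have := fun h' => h.1 ⟨hx, h'⟩; omega)
  · intro h
    simp only [decide_eq_true_iff, lev_odd] at h
    simp only [vLine, h.1, if_false]
    rw [oline_b _ h.1, bidx_odd h.2]; rfl
  · intro h
    simp only [decide_eq_true_iff, lev_odd] at h
    simp only [hLine, h.1, if_false]
    rw [oline_b _ h.1, bidx_odd h.2]; rfl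

theorem hLine_dat (p : α → Prop) (hp : ∀ i j, p (H i j)) (x y : ℤ) : p (hLine H x y).dat := by
  unfold hLine
  split_ifs
  · exact hp _ _
  · exact hp _ _

end

/-! ### A universal Post-Turing machine -/

theorem primrec_two_pow : Primrec (fun n : ℕ => 2 ^ n) := by
  have : Primrec (fun n : ℕ => Nat.rec (motive := fun _ => ℕ) 1 (fun _ ih => 2 * ih) n) :=
    Primrec.nat_rec₁ 1 (Primrec.nat_mul.comp₂ (Primrec₂.const 2) Primrec₂.right)
  refine this.of_eq fun n => ?_
  induction n with
  | zero => rfl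
  | succ n ih => rw [pow_succ', ← ih]

def ulog (m : ℕ) : ℕ := Nat.findGreatest (fun n => 2 ^ n ≤ m) m

theorem ulog_two_pow (n : ℕ) : ulog (2 ^ n) = n := by
  unfold ulog
  rw [Nat.findGreatest_eq_iff]
  refine ⟨Nat.lt_two_pow_self.le, fun _ => le_rfl, fun m hm _ h => ?_⟩
  have := (Nat.pow_le_pow_iff_right (a := 2) (by norm_num)).1 h
  omega

theorem primrec_ulog : Primrec ulog := by
  unfold ulog
  exact Primrec.nat_findGreatest Primrec.id
    (Primrec.nat_le.comp₂ (primrec_two_pow.comp₂ Primrec₂.right) Primrec₂.left)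

def univFn (m : ℕ) : Part ℕ := (Denumerable.ofNat Nat.Partrec.Code (ulog m)).eval 0

theorem partrec_univFn : Partrec univFn :=
  Nat.Partrec.Code.eval_part.comp ((Computable.ofNat _).comp primrec_ulog.to_comp)
    (Computable.const 0)

theorem univFn_spec (c : Nat.Partrec.Code) : univFn (2 ^ Encodable.encode c) = c.eval 0 := by
  rw [univFn, ulog_two_pow, Denumerable.ofNat_encode]

open Turing in
theorem trNat_two_pow (n : ℕ) : PartrecToTM2.trNat (2 ^ n) =
    List.replicate n PartrecToTM2.Γ'.bit0 ++ [PartrecToTM2.Γ'.bit1] := by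
  induction n with
  | zero => rfl
  | succ n ih =>
    have h0 : ((2 ^ n : ℕ) : Num) ≠ 0 := by
      intro h
      have := congrArg (fun x : Num => (x : ℕ)) h
      rw [Num.to_of_nat] at this
      exact absurd this (by positivity)
    unfold PartrecToTM2.trNat at ih ⊢
    have h2 : ((2 ^ (n+1) : ℕ) : Num) = Num.bit0 ((2 ^ n : ℕ) : Num) := by
      rw [pow_succ', ← Num.ofNat'_eq, ← Num.ofNat'_eq]
      have := Num.ofNat'_bit false (2^n)
      simpa [Nat.bit] using this
    rw [h2]
    generalize ((2 ^ n : ℕ) : Num) = z at h0 ih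
    cases z with
    | zero => exact absurd rfl h0
    | pos p =>
      rw [List.replicate_succ, List.cons_append, ← ih]
      rfl

abbrev USym : Type := Turing.TM2to1.Γ' Turing.PartrecToTM2.K' (fun _ => Turing.PartrecToTM2.Γ')

def usym (b : Bool) (x : Turing.PartrecToTM2.Γ') : USym :=
  (b, Function.update (fun _ => none) Turing.PartrecToTM2.K'.main (some x))

open Turing in
theorem usym_finite : Finite USym := by
  have : Finite PartrecToTM2.K' := by
    refine Finite.of_injective (β := Fin 4)
      (fun k => match k with | .main => 0 | .rev => 1 | .aux => 2 | .stack => 3) ?_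
    intro a b h
    cases a <;> cases b <;> first | rfl | (exact absurd h (by decide))
  exact inferInstanceAs (Finite (Bool × (PartrecToTM2.K' → Option PartrecToTM2.Γ')))

open Turing in
theorem usym_init (n : ℕ) : TM2to1.trInit (Γ := fun _ => PartrecToTM2.Γ') PartrecToTM2.K'.main
      (PartrecToTM2.trList [2 ^ n]) =
    usym true PartrecToTM2.Γ'.cons :: usym false PartrecToTM2.Γ'.bit1 ::
    List.replicate n (usym false PartrecToTM2.Γ'.bit0) := by
  have : (PartrecToTM2.trList [2 ^ n]).reverse = PartrecToTM2.Γ'.cons :: PartrecToTM2.Γ'.bit1 ::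
    List.replicate n PartrecToTM2.Γ'.bit0 := by
    simp [trNat_two_pow]
  unfold TM2to1.trInit
  rw [this]
  have h2 : List.replicate n (usym false PartrecToTM2.Γ'.bit0) =
      List.map (usym false) (List.replicate n PartrecToTM2.Γ'.bit0) := by
    rw [List.map_replicate]
  rw [h2]
  rfl

open Turing in
theorem exists_machine : ∃ (Γ Q : Type) (_ : Finite Γ) (_ : Inhabited Γ) (_ : Finite Q)
    (_ : Inhabited Q) (M : TM0.Machine Γ Q) (a b g : Γ), ∀ c : Nat.Partrec.Code,
    (StateTransition.eval (TM0.step M)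
      (TM0.init (a :: b :: List.replicate (Encodable.encode c) g))).Dom ↔ (c.eval 0).Dom := by
  obtain ⟨c, hc⟩ := ToPartrec.Code.exists_code (Nat.Partrec'.part_iff₁.2 partrec_univFn)
  let : Inhabited PartrecToTM2.Λ' := ⟨PartrecToTM2.trNormal c PartrecToTM2.Cont'.halt⟩
  have s2 := PartrecToTM2.tr_supports c PartrecToTM2.Cont'.halt
  have s1 := TM2to1.tr_supports _ s2
  have s0 := TM1to0.tr_supports _ s1
  set M1 := TM2to1.tr PartrecToTM2.tr with hM1
  set M0 := TM1to0.tr M1 with hM0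
  set S := TM1to0.trStmts M1 (TM2to1.trSupp PartrecToTM2.tr
    (PartrecToTM2.codeSupp c PartrecToTM2.Cont'.halt)) with hS
  let : Inhabited S := ⟨⟨default, s0.1⟩⟩
  classical
  let f : PointedMap (TM2to1.Γ' PartrecToTM2.K' (fun _ => PartrecToTM2.Γ'))
    (TM2to1.Γ' PartrecToTM2.K' (fun _ => PartrecToTM2.Γ')) := ⟨id, rfl⟩
  let g1 : PointedMap (TM1to0.Λ' M1) S :=
    ⟨fun q => if h : q ∈ S then ⟨q, h⟩ else default, by
      have : default ∈ S := s0.1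
      simp [this]; rfl⟩
  let g2 : S → TM1to0.Λ' M1 := Subtype.val
  have hr := TM0.Machine.map_respects M0 f f g1 g2 s0 (fun x => rfl) (by
    intro q hq
    have hq' : q ∈ S := hq
    change (if h : q ∈ S then (⟨q, h⟩ : S) else default).1 = q
    rw [dif_pos hq'])
  refine ⟨USym, S, usym_finite, inferInstance, inferInstance, inferInstance, M0.map f f g1 g2,
    usym true PartrecToTM2.Γ'.cons, usym false PartrecToTM2.Γ'.bit1,
    usym false PartrecToTM2.Γ'.bit0, ?_⟩
  intro p
  set n := Encodable.encode p with hn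
  rw [← usym_init]
  have h1 : (StateTransition.eval (TM0.step (M0.map f f g1 g2))
      (TM0.init (TM2to1.trInit PartrecToTM2.K'.main (PartrecToTM2.trList [2 ^ n])))).Dom ↔
      (TM0.eval M0 (TM2to1.trInit PartrecToTM2.K'.main (PartrecToTM2.trList [2 ^ n]))).Dom := by
    refine StateTransition.tr_eval_dom hr ⟨s0.1, ?_⟩
    rw [TM0.map_init]
    congr 1
    exact List.map_id _
  rw [h1, TM1to0.tr_eval]
  refine (TM2to1.tr_eval_dom PartrecToTM2.tr PartrecToTM2.K'.main _).trans ?_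
  have h2 : (TM2.eval PartrecToTM2.tr PartrecToTM2.K'.main (PartrecToTM2.trList [2 ^ n])).Dom ↔
      (StateTransition.eval (TM2.step PartrecToTM2.tr) (PartrecToTM2.init c [2 ^ n])).Dom := by
    have : TM2.init PartrecToTM2.K'.main (PartrecToTM2.trList [2 ^ n]) =
      PartrecToTM2.init c [2 ^ n] := by
      unfold TM2.init PartrecToTM2.init
      congr 1
      funext k
      cases k <;> rfl
    rw [← this]
    rfl
  rw [h2, PartrecToTM2.tr_eval]
  have := hc ⟨[2 ^ n], rfl⟩
  change c.eval [2 ^ n] = pure <$> univFn (2 ^ n) at this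
  rw [this, hn, univFn_spec]
  rfl

/-! ### The computation rule -/

section Computation
open Turing
variable {Γ Q : Type} [Inhabited Γ] [Inhabited Q] (M : TM0.Machine Γ Q) (a b g : Γ)

abbrev VD (Γ Q : Type) : Type := Q × Γ × Γ
abbrev KD (Γ Q : Type) : Type := Γ × VD Γ Q × VD Γ Q

def nextV (cb : Bool) (s : TM0.Stmt Γ) (q' : Q) (v wl er : VD Γ Q) : VD Γ Q :=
  match s with
  | TM0.Stmt.write x => (q', if cb = true then x else v.2.1, v.2.2)
  | TM0.Stmt.move Dir.right => (q', er.2.1, if cb = true then v.2.1 else wl.2.2)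
  | TM0.Stmt.move Dir.left => (q', if cb = true then v.2.2 else wl.2.1, er.2.2)

def DK (cb rb : Bool) (W : KD Γ Q) (S : VD Γ Q) (E : KD Γ Q) (N : VD Γ Q) : Prop :=
  E.1 = (if cb = true then E.2.1.2.1 else W.1) ∧ (cb = false → W.2.2 = E.2.1) ∧
  (rb = false → S = E.2.1) ∧
  (rb = true → E.2.1.1 = default ∧ E.2.1.2.2 = default) ∧
  ∃ q' s, M E.2.1.1 E.1 = some (q', s) ∧ N = nextV cb s q' E.2.1 W.2.1 E.2.2

def initSym (n e : ℕ) : Γ :=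
  if e = 0 then a else if e = 1 then b else if e = n + 2 then default else g

def CR (n : ℕ) (cb rb : Bool) (w e : ℕ) (x : Γ) : Prop :=
  if rb = true then e = (if cb = true then 0 else min (w + 1) (n + 2)) ∧ x = initSym a b g n e
  else e = 0

def DD (n : ℕ) : DatRule (ℕ × KD Γ Q) (VD Γ Q) := fun cb rb W S E N =>
  DK M cb rb W.2 S E.2 N ∧ CR a b g n cb rb W.1 E.1 E.2.2.1.2.1

def cont (c : TM0.Cfg Γ Q) (i : ℕ) : VD Γ Q := (c.q, c.Tape.nth i, c.Tape.nth (-1 - (i : ℤ)))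

def stepWith (c : TM0.Cfg Γ Q) (q' : Q) (s : TM0.Stmt Γ) : TM0.Cfg Γ Q :=
  ⟨q', match s with
    | TM0.Stmt.move d => c.Tape.move d
    | TM0.Stmt.write a => c.Tape.write a⟩

theorem step_eq (c : TM0.Cfg Γ Q) (q' : Q) (s : TM0.Stmt Γ)
    (h : M c.q (c.Tape.nth 0) = some (q', s)) : TM0.step M c = some (stepWith c q' s) := by
  obtain ⟨q, T⟩ := c
  rw [Tape.nth_zero] at h
  simp only at h
  simp only [TM0.step, h]
  rfl

theorem step_some (c c' : TM0.Cfg Γ Q) (h : TM0.step M c = some c') :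
    ∃ q' s, M c.q (c.Tape.nth 0) = some (q', s) ∧ c' = stepWith c q' s := by
  cases hM : M c.q (c.Tape.nth 0) with
  | none =>
    obtain ⟨q, T⟩ := c
    rw [Tape.nth_zero] at hM
    simp only at hM
    simp [TM0.step, hM] at h
  | some p =>
    obtain ⟨q', s⟩ := p
    rw [step_eq M c q' s hM] at h
    exact ⟨q', s, rfl, (Option.some.inj h).symm⟩

theorem nextV_cont (c : TM0.Cfg Γ Q) (q' : Q) (s : TM0.Stmt Γ) (i : ℕ) (wl : VD Γ Q)
    (hw : ∀ i', i = i' + 1 → wl = cont c i') :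
    nextV (decide (i = 0)) s q' (cont c i) wl (cont c (i+1)) = cont (stepWith c q' s) i := by
  rcases i with _ | i
  · match s with
    | TM0.Stmt.write x => simp [nextV, cont, stepWith, Tape.write_nth]; rfl
    | TM0.Stmt.move Dir.right => simp [nextV, cont, stepWith, Tape.move_right_nth, -Tape.nth_zero]
    | TM0.Stmt.move Dir.left => simp [nextV, cont, stepWith, Tape.move_left_nth, -Tape.nth_zero]
  · rw [hw i rfl]
    match s with
    | TM0.Stmt.write x =>
      have h1 : (i : ℤ) + 1 ≠ 0 := by omega
      have h2 : (-1 : ℤ) - (i + 1) ≠ 0 := by omega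
      simp [nextV, cont, stepWith, Tape.write_nth, h1, h2]
    | TM0.Stmt.move Dir.right =>
      simp only [nextV, cont, stepWith, Tape.move_right_nth]
      simp
      congr 1; ring
    | TM0.Stmt.move Dir.left =>
      simp only [nextV, cont, stepWith, Tape.move_left_nth]
      simp
      congr 1

theorem init_nth (n i : ℕ) :
    (TM0.init (Λ := Q) (a :: b :: List.replicate n g)).Tape.nth i
      = initSym a b g n (min i (n+2)) := by
  have h1 : (TM0.init (Λ := Q) (a :: b :: List.replicate n g)).Tape.nth i =
      (a :: b :: List.replicate n g).getI i := by
    simp only [TM0.init, Tape.mk₁, Tape.mk₂, Tape.mk'_nth_nat, ListBlank.nth_mk]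
  rw [h1]
  unfold initSym
  rcases i with _ | _ | i
  · simp
  · simp
  · simp only [List.getI_cons_succ]
    have : ¬ (min (i + 1 + 1) (n + 2) = 0) := by omega
    have h' : ¬ (min (i + 1 + 1) (n + 2) = 1) := by omega
    simp only [this, h', if_false]
    split_ifs with h
    · rw [List.getI_eq_default]
      simp; omega
    · rw [List.getI_eq_getElem _ (by simp; omega)]
      simp

theorem init_nth_neg (n i : ℕ) :
    (TM0.init (Λ := Q) (a :: b :: List.replicate n g)).Tape.nth (-1 - (i : ℤ)) = default := by
  have : (-1 - (i : ℤ)) = Int.negSucc i := by rw [Int.negSucc_eq]; ring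
  rw [this]
  simp only [TM0.init, Tape.mk₁, Tape.mk₂, Tape.nth, Tape.mk'_left, ListBlank.nth_mk]
  simp [List.getI_nil]

def run (c0 : TM0.Cfg Γ Q) : ℕ → Option (TM0.Cfg Γ Q)
  | 0 => some c0
  | j + 1 => (run c0 j).bind (TM0.step M)

theorem run_sound (c0 : TM0.Cfg Γ Q) (h : ∀ j, (run M c0 j).isSome) :
    ¬ (StateTransition.eval (TM0.step M) c0).Dom := by
  intro hd
  obtain ⟨hr, hn⟩ := StateTransition.mem_eval.1 (Part.get_mem hd)
  generalize (StateTransition.eval (TM0.step M) c0).get hd = e at hr hn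
  have : ∃ j, run M c0 j = some e := by
    clear hn
    induction hr with
    | refl => exact ⟨0, rfl⟩
    | tail _ hs ih =>
      obtain ⟨j, hj⟩ := ih
      exact ⟨j+1, by simp only [run, hj]; exact hs⟩
  obtain ⟨j, hj⟩ := this
  have := h (j+1)
  simp [run, hj, hn] at this

theorem run_complete (c0 : TM0.Cfg Γ Q) (h : ¬ (StateTransition.eval (TM0.step M) c0).Dom) :
    ∃ f : ℕ → TM0.Cfg Γ Q, f 0 = c0 ∧ ∀ j, TM0.step M (f j) = some (f (j+1)) := by
  have : ∀ j, ∃ c, run M c0 j = some c ∧ StateTransition.Reaches (TM0.step M) c0 c := by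
    intro j
    induction j with
    | zero => exact ⟨c0, rfl, Relation.ReflTransGen.refl⟩
    | succ j ih =>
      obtain ⟨c, h1, h2⟩ := ih
      cases hs : TM0.step M c with
      | none => exact absurd (Part.dom_iff_mem.2 ⟨c, StateTransition.mem_eval.2 ⟨h2, hs⟩⟩) h
      | some c' => exact ⟨c', by simp [run, h1, hs], h2.tail hs⟩
  choose f hf1 hf2 using this
  refine ⟨f, ?_, fun j => ?_⟩
  · have := hf1 0
    simp only [run, Option.some.injEq] at this
    exact this.symm
  · have := hf1 (j+1)
    simpa only [run, hf1 j, Option.bind_some] using this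

theorem comp_sound (n N : ℕ) (H : ℕ → ℕ → ℕ × KD Γ Q) (V : ℕ → ℕ → VD Γ Q)
    (hD : ∀ i j, i < N → j < N → DD M a b g n (decide (i = 0)) (decide (j = 0))
      (H i j) (V i j) (H (i+1) j) (V i (j+1))) (j : ℕ) (hj : j < N) :
    ∃ c, run M (TM0.init (a :: b :: List.replicate n g)) j = some c ∧
      ∀ i, i + j < N → (H (i+1) j).2.2.1 = cont c i := by
  induction j with
  | zero =>
    refine ⟨_, rfl, ?_⟩
    have hc : ∀ i, i < N → (H (i+1) 0).1 = min i (n+2) := by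
      intro i
      induction i with
      | zero =>
        intro hi
        have := (hD 0 0 hi hj).2
        simp [CR] at this
        rw [this.1]; simp
      | succ i ih =>
        intro hi
        have := (hD (i+1) 0 hi hj).2
        simp only [CR, decide_true, if_true] at this
        rw [this.1, ih (by omega)]; simp
    intro i hi
    have h1 := (hD i 0 hi hj).2
    have h2 := (hD i 0 hi hj).1.2.2.2.1 (by simp)
    simp only [CR, decide_true, if_true] at h1
    have h3 := h1.2
    rw [hc i hi, ← init_nth (Q := Q)] at h3
    refine Prod.ext ?_ (Prod.ext ?_ ?_)
    · rw [h2.1]; rfl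
    · rw [h3]; rfl
    · rw [h2.2]; exact (init_nth_neg a b g n i).symm
  | succ j ih =>
    obtain ⟨c, hrun, hc⟩ := ih (by omega)
    have hhs : ∀ i, i < N → (H (i+1) j).2.1 = c.Tape.nth 0 := by
      intro i
      induction i with
      | zero =>
        intro hi
        have := (hD 0 j hi (by omega)).1.1
        rw [this, hc 0 (by omega)]; simp [cont]
      | succ i ih =>
        intro hi
        have := (hD (i+1) j hi (by omega)).1.1
        rw [this, ← ih (by omega)]; simp
    have hex := (hD 0 j (by omega) (by omega)).1.2.2.2.2
    rw [hc 0 (by omega), hhs 0 (by omega)] at hex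
    obtain ⟨q', s, hM, -⟩ := hex
    have hM' : M c.q (c.Tape.nth 0) = some (q', s) := hM
    refine ⟨stepWith c q' s, by simp only [run, hrun]; exact step_eq M c q' s hM', ?_⟩
    intro i hi
    have h1 := (hD i (j+1) (by omega) hj).1.2.2.1 (by simp)
    rw [← h1]
    obtain ⟨q'', s'', hM2, hN⟩ := (hD i j (by omega) (by omega)).1.2.2.2.2
    rw [hc i (by omega), hhs i (by omega)] at hM2
    have hM3 : M c.q (c.Tape.nth 0) = some (q'', s'') := hM2
    rw [hM'] at hM3
    simp only [Option.some.injEq, Prod.mk.injEq] at hM3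
    obtain ⟨rfl, rfl⟩ := hM3
    have her : (H (i+1) j).2.2.2 = cont c (i+1) := by
      have := (hD (i+1) j (by omega) (by omega)).1.2.1 (by simp)
      rw [this, hc (i+1) (by omega)]
    rw [hN, hc i (by omega), her]
    apply nextV_cont
    rintro i' rfl
    exact hc i' (by omega)

theorem comp_complete (n : ℕ) (f : ℕ → TM0.Cfg Γ Q)
    (h0 : f 0 = TM0.init (a :: b :: List.replicate n g))
    (hf : ∀ j, TM0.step M (f j) = some (f (j+1))) :
    ∃ (H : ℕ → ℕ → ℕ × KD Γ Q) (V : ℕ → ℕ → VD Γ Q), (∀ i j, (H i j).1 ≤ n + 2) ∧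
      ∀ i j w s, (i ≠ 0 → w = H i j) → (j ≠ 0 → s = V i j) →
        DD M a b g n (decide (i = 0)) (decide (j = 0)) w s (H (i+1) j) (V i (j+1)) := by
  refine ⟨fun i j => (if j = 0 then min (i-1) (n+2) else 0,
    (f j).Tape.nth 0, cont (f j) (i-1), cont (f j) i), fun i j => cont (f j) i, ?_, ?_⟩
  · intro i j
    simp only
    split_ifs <;> omega
  intro i j w s hw hs
  obtain ⟨q', st, hM, hst⟩ := step_some M _ _ (hf j)
  refine ⟨⟨?_, ?_, ?_, ?_, q', st, hM, ?_⟩, ?_⟩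
  · by_cases hi : i = 0
    · subst hi; simp [cont]
    · simp [hw hi, hi]
  · intro hi
    have hi' : i ≠ 0 := by simpa using hi
    simp [hw hi']
  · intro hj
    have hj' : j ≠ 0 := by simpa using hj
    simp [hs hj']
  · intro hj
    have hj' : j = 0 := by simpa using hj
    subst hj'
    constructor
    · simp only [cont, h0]; rfl
    · simp only [cont, h0]; exact init_nth_neg a b g n _
  · simp only [Nat.add_sub_cancel]
    rw [nextV_cont, ← hst]
    rintro i' rfl
    rw [hw (by omega)]
    simp
  · unfold CR
    by_cases hj : j = 0
    · subst hj
      simp only [decide_true, if_true, Nat.add_sub_cancel]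
      refine ⟨?_, ?_⟩
      · by_cases hi : i = 0
        · subst hi; simp
        · rw [hw hi]; simp [hi]; omega
      · simp only [cont, h0]; exact init_nth a b g n i
    · simp [hj]

end Computation

/-! ### Encoding by Wang tiles -/

section Encoding

theorem line_finite (α : Type) [Finite α] : Finite (Line α) := by
  refine Finite.of_injective (β := ZMod 4 × Bool × Bool × ZMod 4 × Bool × α)
    (fun L => (L.d, L.l, L.b, L.s, L.r, L.dat)) ?_
  rintro ⟨⟩ ⟨⟩ h
  simp only [Prod.mk.injEq] at h
  simp only [Line.mk.injEq]
  exact h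

def withC {α : Type} (c : ℕ) (L : Line α) : Line (ℕ × α) := ⟨L.d, L.l, L.b, L.s, L.r, (c, L.dat)⟩

def stripC {α : Type} (L : Line (ℕ × α)) : Line α := ⟨L.d, L.l, L.b, L.s, L.r, L.dat.2⟩

theorem withC_stripC {α : Type} (L : Line (ℕ × α)) : withC L.dat.1 (stripC L) = L := rfl

theorem withC_inj {α : Type} {c c' : ℕ} {L L' : Line α} :
    withC c L = withC c' L' ↔ c = c' ∧ L = L' := by
  obtain ⟨⟩ := L
  obtain ⟨⟩ := L'
  simp only [withC, Line.mk.injEq, Prod.mk.injEq]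
  tauto

theorem pp_const {α : Type} [Primcodable α] (p : Prop) : PrimrecPred (fun _ : α => p) := by
  classical
  exact ⟨fun _ => Classical.propDecidable p, Primrec.const _⟩

variable {α β Θ : Type} {P : ℕ → ℕ → ℕ → Θ → Prop}

open Classical in
noncomputable def gList (P : ℕ → ℕ → ℕ → Θ → Prop) (code : ℕ → ℕ → Θ → WangTile) (t : Θ) (n : ℕ) :
    List WangTile :=
  (List.range (n+3)).flatMap fun c => (List.range (n+3)).flatMap fun c' =>
    if P n c c' t then [code c c' t] else []

theorem gList_primrec (P : ℕ → ℕ → ℕ → Θ → Prop) (code : ℕ → ℕ → Θ → WangTile) (t : Θ)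
    (hP : PrimrecPred (fun x : ℕ × ℕ × ℕ => P x.1 x.2.1 x.2.2 t))
    (hc : Primrec (fun x : ℕ × ℕ => code x.1 x.2 t)) : Primrec (gList P code t) := by
  classical
  unfold gList
  have hr : Primrec (fun n : ℕ => List.range (n+3)) :=
    Primrec.list_range.comp (Primrec.nat_add.comp Primrec.id (Primrec.const 3))
  refine Primrec.list_flatMap hr (Primrec.list_flatMap (hr.comp Primrec.fst) ?_)
  refine Primrec.ite ?_ ?_ (Primrec.const [])
  · exact hP.comp (Primrec.pair (Primrec.fst.comp Primrec.fst)
      (Primrec.pair (Primrec.snd.comp Primrec.fst) Primrec.snd))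
  · exact Primrec.list_cons.comp (hc.comp (Primrec.pair (Primrec.snd.comp Primrec.fst) Primrec.snd))
      (Primrec.const [])

theorem flat_primrec (G : Θ → ℕ → List WangTile) (hG : ∀ t, Primrec (G t)) (l : List Θ) :
    Primrec (fun n => l.flatMap fun t => G t n) := by
  induction l with
  | nil => exact Primrec.const []
  | cons t l ih =>
    simp only [List.flatMap_cons]
    exact Primrec.list_append.comp (hG t) ih

theorem mem_flat (P : ℕ → ℕ → ℕ → Θ → Prop) (code : ℕ → ℕ → Θ → WangTile) (l : List Θ) (n : ℕ)
    (w : WangTile) : w ∈ (l.flatMap fun t => gList P code t n) ↔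
      ∃ t ∈ l, ∃ c c', c < n+3 ∧ c' < n+3 ∧ P n c c' t ∧ w = code c c' t := by
  classical
  simp only [gList, List.mem_flatMap, List.mem_range]
  constructor
  · rintro ⟨t, ht, c, hc, c', hc', h⟩
    split_ifs at h with hp
    · exact ⟨t, ht, c, c', hc, hc', hp, by simpa using h⟩
    · simp at h
  · rintro ⟨t, ht, c, c', hc, hc', hp, rfl⟩
    exact ⟨t, ht, c, hc, c', hc', by simp [hp]⟩

end Encoding

section Final
open Turing
variable {Γ Q : Type} [Inhabited Γ] [Inhabited Q] (M : TM0.Machine Γ Q) (a b g : Γ)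

abbrev AH (Γ Q : Type) : Type := Line (KD Γ Q) × Bool × Bool
abbrev AV (Γ Q : Type) : Type := Line (VD Γ Q) × Bool × Bool
abbrev TH (Γ Q : Type) : Type := AH Γ Q × AV Γ Q × AH Γ Q × AV Γ Q

def FT (n c c' : ℕ) (t : TH Γ Q) : Prop :=
  FullTile (DD M a b g n) (withC c t.1.1, t.1.2) t.2.1 (withC c' t.2.2.1.1, t.2.2.1.2) t.2.2.2

theorem CR_primrec (cb rb : Bool) (x : Γ) :
    PrimrecPred (fun z : ℕ × ℕ × ℕ => CR a b g z.1 cb rb z.2.1 z.2.2 x) := by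
  have hc' : Primrec (fun z : ℕ × ℕ × ℕ => z.2.2) := Primrec.snd.comp Primrec.snd
  have hc : Primrec (fun z : ℕ × ℕ × ℕ => z.2.1) := Primrec.fst.comp Primrec.snd
  have hn : Primrec (fun z : ℕ × ℕ × ℕ => z.1 + 2) :=
    Primrec.nat_add.comp Primrec.fst (Primrec.const 2)
  have hk : ∀ k : ℕ, PrimrecPred (fun z : ℕ × ℕ × ℕ => z.2.2 = k) := fun k =>
    Primrec.eq.comp hc' (Primrec.const k)
  have hs : PrimrecPred (fun z : ℕ × ℕ × ℕ => x = initSym a b g z.1 z.2.2) := by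
    have : PrimrecPred (fun z : ℕ × ℕ × ℕ => (z.2.2 = 0 ∧ x = a) ∨ (¬ z.2.2 = 0 ∧
        ((z.2.2 = 1 ∧ x = b) ∨ (¬ z.2.2 = 1 ∧ ((z.2.2 = z.1 + 2 ∧ x = default) ∨
          (¬ z.2.2 = z.1 + 2 ∧ x = g)))))) := by
      have he := Primrec.eq.comp hc' hn
      exact ((hk 0).and (pp_const _)).or ((hk 0).not.and (((hk 1).and (pp_const _)).or
        ((hk 1).not.and ((he.and (pp_const _)).or (he.not.and (pp_const _))))))
    refine this.of_eq fun z => ?_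
    unfold initSym
    split_ifs <;> simp_all
  cases rb
  · exact (hk 0).of_eq fun z => by simp [CR]
  · cases cb
    · refine PrimrecPred.of_eq (PrimrecPred.and (Primrec.eq.comp hc'
        (Primrec.nat_min.comp (Primrec.nat_add.comp hc (Primrec.const 1)) hn)) hs) fun z => ?_
      simp [CR]
    · exact ((hk 0).and hs).of_eq fun z => by simp [CR]

theorem Tile_primrec (W : Line (KD Γ Q)) (S : Line (VD Γ Q)) (E : Line (KD Γ Q))
    (N : Line (VD Γ Q)) :
    (PrimrecPred (fun z : ℕ × ℕ × ℕ => TA (withC z.2.1 W) S (withC z.2.2 E) N)) ∧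
    (PrimrecPred (fun z : ℕ × ℕ × ℕ => TB (withC z.2.1 W) S (withC z.2.2 E) N)) ∧
    (PrimrecPred (fun z : ℕ × ℕ × ℕ =>
      TC (DD M a b g z.1) (withC z.2.1 W) S (withC z.2.2 E) N)) := by
  have hc' : Primrec (fun z : ℕ × ℕ × ℕ => z.2.2) := Primrec.snd.comp Primrec.snd
  have hc : Primrec (fun z : ℕ × ℕ × ℕ => z.2.1) := Primrec.fst.comp Primrec.snd
  have he : PrimrecPred (fun z : ℕ × ℕ × ℕ => z.2.2 = z.2.1) := Primrec.eq.comp hc' hc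
  refine ⟨?_, ?_, ?_⟩
  · refine (he.and (pp_const (E = W ∧ Wrap S N W))).of_eq fun z => ?_
    unfold TA
    rw [withC_inj]
    have : Wrap S N (withC z.2.1 W) ↔ Wrap S N W := Iff.rfl
    rw [this]; tauto
  · refine (he.and (pp_const (N = S ∧ Wrap W E S))).of_eq fun z => ?_
    unfold TB Wrap
    have h1 : {withC z.2.1 W with d := (withC z.2.1 W).d + 1} =
      withC z.2.1 {W with d := W.d + 1} := rfl
    rw [h1, withC_inj]
    simp only [withC]
    tauto
  · refine ((pp_const (Act W E S ∧ Act S N W ∧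
      DK M S.b W.b W.dat S.dat E.dat N.dat)).and
        (CR_primrec a b g S.b W.b E.dat.2.1.2.1)).of_eq fun z => ?_
    unfold TC DD
    have h1 : Act (withC z.2.1 W) (withC z.2.2 E) S ↔ Act W E S := Iff.rfl
    have h2 : Act S N (withC z.2.1 W) ↔ Act S N W := Iff.rfl
    rw [h1, h2]
    simp only [withC]
    tauto

theorem pp_imp {α : Type} [Primcodable α] (p : Prop) {q : α → Prop} (hq : PrimrecPred q) :
    PrimrecPred (fun x => p → q x) :=
  ((pp_const (¬ p)).or hq).of_eq fun x => by tauto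

theorem FT_primrec (t : TH Γ Q) :
    PrimrecPred (fun z : ℕ × ℕ × ℕ => FT M a b g z.1 z.2.1 z.2.2 t) := by
  obtain ⟨hA, hB, hC⟩ := Tile_primrec M a b g t.1.1 t.2.1.1 t.2.2.1.1 t.2.2.2.1
  exact ((pp_const (t.2.1.2 = t.1.2)).and ((pp_const (t.2.2.1.2 = (!t.1.2.1, t.1.2.2))).and
    ((pp_const (t.2.2.2.2 = (t.1.2.1, !t.1.2.2))).and ((hA.or (hB.or hC)).and
    ((pp_imp (t.1.2 = (true, true)) hC).and ((pp_imp (t.1.2 = (true, false)) hA).and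
      ((pp_imp (t.1.2 = (false, true)) hB).and
      ((pp_const (t.1.2.1 = true → t.2.1.1.b = true)).and
        (pp_const (t.1.2.2 = true → t.1.1.b = true)))))))))).of_eq fun z => Iff.rfl

theorem exists_tileset [Finite Γ] [Finite Q] : ∃ F : ℕ → List WangTile, Primrec F ∧ ∀ n,
    (∃ f, IsWangTilingL (F n) f) ↔
      ∃ (h : ℤ → ℤ → Line (ℕ × KD Γ Q) × Bool × Bool) (v : ℤ → ℤ → Line (VD Γ Q) × Bool × Bool),
        (∀ x y, (h x y).1.dat.1 ≤ n + 2) ∧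
        ∀ x y, FullTile (DD M a b g n) (h x y) (v x y) (h (x+1) y) (v x (y+1)) := by
  have := line_finite (KD Γ Q)
  have := line_finite (VD Γ Q)
  obtain ⟨eH, heH⟩ := Countable.exists_injective_nat (AH Γ Q)
  obtain ⟨eV, heV⟩ := Countable.exists_injective_nat (AV Γ Q)
  let code : ℕ → ℕ → TH Γ Q → WangTile := fun c c' t =>
    (Nat.pair c (eH t.1), eV t.2.1, Nat.pair c' (eH t.2.2.1), eV t.2.2.2)
  obtain ⟨l, hl⟩ : ∃ l : List (TH Γ Q), ∀ t, t ∈ l := by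
    have := Fintype.ofFinite (TH Γ Q)
    exact ⟨Finset.univ.toList, fun t => by simp⟩
  refine ⟨fun n => l.flatMap fun t => gList (FT M a b g) code t n, ?_, ?_⟩
  · refine flat_primrec _ (fun t => gList_primrec _ _ _ (FT_primrec M a b g t) ?_) l
    exact Primrec.pair (Primrec₂.natPair.comp Primrec.fst (Primrec.const _))
      (Primrec.pair (Primrec.const _) (Primrec.pair
        (Primrec₂.natPair.comp Primrec.snd (Primrec.const _)) (Primrec.const _)))
  · intro n
    constructor
    · rintro ⟨f, hf, hm⟩
      have h1 := fun p => (mem_flat (FT M a b g) code l n (f p)).1 (hf p)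
      choose t _ c c' hc hc' hP hcode using h1
      refine ⟨fun x y => (withC (c (x, y)) (t (x, y)).1.1, (t (x, y)).1.2),
        fun x y => (t (x, y)).2.1, ?_, ?_⟩
      · intro x y
        have := hc (x, y)
        change c (x, y) ≤ n + 2
        omega
      · intro x y
        obtain ⟨m1, m2⟩ := hm x y
        rw [hcode, hcode (x+1, y)] at m1
        rw [hcode, hcode (x, y+1)] at m2
        simp only [WangTile.east, WangTile.west, WangTile.north, WangTile.south, code,
          Nat.pair_eq_pair] at m1 m2
        have e1 := heH m1.2
        have e2 := heV m2
        have := hP (x, y)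
        unfold FT at this
        rw [e1, e2, m1.1] at this
        exact this
    · rintro ⟨h, v, hb, ht⟩
      let s : ℤ → ℤ → AH Γ Q := fun x y => (stripC (h x y).1, (h x y).2)
      refine ⟨fun p => code (h p.1 p.2).1.dat.1 (h (p.1+1) p.2).1.dat.1
        (s p.1 p.2, v p.1 p.2, s (p.1+1) p.2, v p.1 (p.2+1)), ?_, ?_⟩
      · intro p
        rw [mem_flat]
        have h1 := hb p.1 p.2
        have h2 := hb (p.1+1) p.2
        exact ⟨(s p.1 p.2, v p.1 p.2, s (p.1+1) p.2, v p.1 (p.2+1)), hl _, (h p.1 p.2).1.dat.1,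
          (h (p.1+1) p.2).1.dat.1, by omega, by omega, ht p.1 p.2, rfl⟩
      · intro x y
        exact ⟨rfl, rfl⟩

theorem tiles_iff (n : ℕ) :
    (∃ (h : ℤ → ℤ → Line (ℕ × KD Γ Q) × Bool × Bool) (v : ℤ → ℤ → Line (VD Γ Q) × Bool × Bool),
        (∀ x y, (h x y).1.dat.1 ≤ n + 2) ∧
        ∀ x y, FullTile (DD M a b g n) (h x y) (v x y) (h (x+1) y) (v x (y+1))) ↔
    ¬ (StateTransition.eval (TM0.step M) (TM0.init (a :: b :: List.replicate n g))).Dom := by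
  constructor
  · rintro ⟨h, v, -, ht⟩
    apply run_sound
    intro j
    obtain ⟨H, V, hD⟩ := full_sound h v ht j
    obtain ⟨c, hc, -⟩ := comp_sound M a b g n (2^j) H V hD j Nat.lt_two_pow_self
    rw [hc]; rfl
  · intro hd
    obtain ⟨f, h0, hf⟩ := run_complete M _ hd
    obtain ⟨H, V, hb, hD⟩ := comp_complete M a b g n f h0 hf
    exact ⟨fun x y => (hLine H x y, decide (Odd x), decide (Odd y)),
      fun x y => (vLine V x y, decide (Odd x), decide (Odd y)),
      fun x y => hLine_dat H (fun z => z.1 ≤ n + 2) hb x y,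
      fun x y => full_complete H V _ hD x y⟩

end Final

end Wang

/-- **Turing machines can be simulated by Wang tiles.** There is a computable map assigning to
every program `c` (in the fixed standard model of computation given by Mathlib's
`Nat.Partrec.Code`, started on the blank input `0`) a Wang tile set `F c` that admits a
tiling of the plane if and only if `c` does not halt. -/
theorem wang_tiles_simulate_turing_machines :
    ∃ F : Nat.Partrec.Code → List WangTile, Computable F ∧
      ∀ c : Nat.Partrec.Code,
        (∃ f, IsWangTilingL (F c) f) ↔ ¬ (Nat.Partrec.Code.eval c 0).Dom := by
  obtain ⟨Γ, Q, hΓ, iΓ, hQ, iQ, M, a, b, g, hM⟩ := Wang.exists_machine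
  obtain ⟨F, hF, hT⟩ := Wang.exists_tileset M a b g
  refine ⟨fun c => F (Encodable.encode c), (hF.comp Primrec.encode).to_comp, fun c => ?_⟩
  rw [hT, Wang.tiles_iff, hM]
end
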